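/- Let Ω ⊂ (0,∞)² be a compact convex polygon with rational vertices and nonempty interior (so X_Ω is a free rational convex toric domain), let v⋆ be an interior point of Ω, and set Ω′ := Ω − v⋆. For a lattice polygon Λ (the convex hull of a finite nonempty subset of ℤ², possibly degenerate) define ℓ′_Ω(∂Λ) := Σ (over edge vectors v of Λ) of max_{p∈Ω′}(v·p), where v·p is the Euclidean inner product. Then for every k ∈ ℤ≥0: min{ℓ′_Ω(∂Λ) : Λ a lattice polygon with #(Λ∩ℤ²) = k+1} = inf{ℓ_{Ω′}(∂Ξ) : Ξ ⊆ ℝ² a nonempty (possibly degenerate) compact convex polygon, each of whose edges is parallel to an edge of Ω, with #(Ξ ∩ ℤ²) ≥ k+1}. (This is the combinatorial content of the identity c_k(X_Ω) = min{D·D_Ω : h⁰(Y_{Σ(Ω)}, D) ≥ k+1} over nef ℝ-divisors for free convex toric domains.) -/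

import Mathlib

open scoped BigOperators Pointwise

noncomputable section

/-- Planar cross product `det(v,p) = v₁p₂ − v₂p₁`. -/
def det2 (v p : ℝ × ℝ) : ℝ := v.1 * p.2 - v.2 * p.1

/-- The `Ω`-length of a vector `v`: `max_{p ∈ Ω} det(v,p)`. -/
def omegaLen (Ω : Set (ℝ × ℝ)) (v : ℝ × ℝ) : ℝ := sSup (det2 v '' Ω)

/-- A (possibly degenerate) compact convex polygon with vertices listed in
clockwise order: a cyclic (period `n`) list of pairwise distinct vertices such
that the polygon (the convex hull of the vertices) lies in the right
half-plane of every directed edge. -/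
structure ClockPolygon where
  n : ℕ
  npos : 0 < n
  verts : ℕ → ℝ × ℝ
  periodic : ∀ i, verts (i + n) = verts i
  inj : ∀ i j, i < n → j < n → verts i = verts j → i = j
  clockwise : ∀ i, ∀ q ∈ convexHull ℝ (Set.range verts),
      det2 (verts (i + 1) - verts i) (q - verts i) ≤ 0

/-- The underlying point set of a polygon. -/
def ClockPolygon.body (P : ClockPolygon) : Set (ℝ × ℝ) :=
  convexHull ℝ (Set.range P.verts)

/-- The `Ω`-perimeter `ℓ_Ω(∂Λ)`: the sum of the `Ω`-lengths of the edge
vectors of `Λ`. -/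
def omegaPerim (Ω : Set (ℝ × ℝ)) (P : ClockPolygon) : ℝ :=
  ∑ i ∈ Finset.range P.n, omegaLen Ω (P.verts (i + 1) - P.verts i)

/-- Lattice points of the plane. -/
def IsLatticePt (p : ℝ × ℝ) : Prop := (∃ m : ℤ, p.1 = m) ∧ (∃ m : ℤ, p.2 = m)

/-- Rational points of the plane. -/
def IsRationalPt (p : ℝ × ℝ) : Prop := (∃ q : ℚ, p.1 = q) ∧ (∃ q : ℚ, p.2 = q)

/-- The number of lattice points in a set. -/
def latticeCount (S : Set (ℝ × ℝ)) : ℕ := {p ∈ S | IsLatticePt p}.ncard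

/-- Competitor convex lattice domains: convex hulls of finite nonempty sets of
lattice points in `ℝ≥0²`, containing the origin and closed under taking
coordinate rectangles. -/
def IsCompetitor (P : ClockPolygon) : Prop :=
  (∀ i, IsLatticePt (P.verts i)) ∧
  (∀ i, 0 ≤ (P.verts i).1 ∧ 0 ≤ (P.verts i).2) ∧
  (((0 : ℝ), (0 : ℝ)) ∈ P.body) ∧
  ∀ q ∈ P.body, Set.Icc (0 : ℝ) q.1 ×ˢ Set.Icc (0 : ℝ) q.2 ⊆ P.body

/-- ECH capacities of `X_Ω`, via Cristofaro-Gardiner's combinatorial formula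
(taken as a definition). -/
def echCap (Ω : Set (ℝ × ℝ)) (k : ℕ) : ℝ :=
  sInf { r | ∃ P : ClockPolygon, IsCompetitor P ∧
      latticeCount P.body = k + 1 ∧ omegaPerim Ω P = r }

/-- The cap function `cap_{X_Ω}(r) = #{k : c_k(X_Ω) ≤ r}`. -/
def capFn (Ω : Set (ℝ × ℝ)) (r : ℝ) : ℕ := {k : ℕ | echCap Ω k ≤ r}.ncard

/-- A convex domain: a convex polygon in `ℝ≥0²` with nonempty interior,
containing the origin and closed under taking coordinate rectangles. -/
structure ConvexDomain where
  P : ClockPolygon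
  int_nonempty : (interior P.body).Nonempty
  nonneg : ∀ q ∈ P.body, 0 ≤ q.1 ∧ 0 ≤ q.2
  zero_mem : (((0 : ℝ), (0 : ℝ)) ∈ P.body)
  rect : ∀ q ∈ P.body, Set.Icc (0 : ℝ) q.1 ×ˢ Set.Icc (0 : ℝ) q.2 ⊆ P.body

def ConvexDomain.body (Ω : ConvexDomain) : Set (ℝ × ℝ) := Ω.P.body

/-- A convex lattice domain: all vertices are lattice points. -/
def ConvexDomain.IsLattice (Ω : ConvexDomain) : Prop :=
  ∀ i, IsLatticePt (Ω.P.verts i)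

/-- A rational convex domain: all vertices are rational points. -/
def ConvexDomain.IsRational (Ω : ConvexDomain) : Prop :=
  ∀ i, IsRationalPt (Ω.P.verts i)

/-- `X_Ω` is tightly constrained with lower bound `r₀` if every integer
`r ≥ r₀` is a value `c_k(X_Ω)`. -/
def TightlyConstrained (Ω : ConvexDomain) (r₀ : ℕ) : Prop :=
  ∀ r : ℕ, r₀ ≤ r → ∃ k : ℕ, echCap Ω.body k = r

/-- Every (nonzero) edge of `Q` is parallel to an edge of `P`. -/
def EdgesParallel (Q P : ClockPolygon) : Prop :=
  ∀ i < Q.n, Q.verts (i + 1) - Q.verts i ≠ 0 →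
    ∃ j < P.n, ∃ t : ℝ, t ≠ 0 ∧
      Q.verts (i + 1) - Q.verts i = t • (P.verts (j + 1) - P.verts j)

/-- Euclidean inner product on the plane. -/
def dot2 (u p : ℝ × ℝ) : ℝ := u.1 * p.1 + u.2 * p.2

/-- The dual-norm value `max_{p ∈ K} u·p` (the support function of `K`). -/
def dualLen (K : Set (ℝ × ℝ)) (u : ℝ × ℝ) : ℝ := sSup (dot2 u '' K)

/-- The pseudonorm length `ℓ'_Ω(∂Λ)` with respect to a translated body `K`. -/
def dualPerim (K : Set (ℝ × ℝ)) (P : ClockPolygon) : ℝ :=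
  ∑ i ∈ Finset.range P.n, dualLen K (P.verts (i + 1) - P.verts i)



/-! ### Directions -/

def HP (u : ℝ × ℝ) : Prop := 0 < u.1 ∨ (u.1 = 0 ∧ 0 < u.2)

lemma HP_or_neg {u : ℝ × ℝ} (hu : u ≠ 0) : HP u ∨ HP (-u) := by
  unfold HP
  rcases lt_trichotomy u.1 0 with h | h | h
  · right; left; simpa using h
  · rcases lt_trichotomy u.2 0 with h' | h' | h'
    · right; right; simp [h, h']
    · exact absurd (Prod.ext h h') hu
    · left; right; exact ⟨h, h'⟩
  · left; left; exact h

lemma HP_not_both {u : ℝ × ℝ} (h : HP u) (h' : HP (-u)) : False := by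
  unfold HP at *
  simp only [Prod.fst_neg, Prod.snd_neg] at h'
  rcases h with h | ⟨h, h1⟩ <;> rcases h' with h' | ⟨h', h1'⟩ <;> linarith

lemma HP_ne {u : ℝ × ℝ} (h : HP u) : u ≠ 0 := by
  rintro rfl
  unfold HP at h; simp at h

lemma HP_trans {a b c : ℝ × ℝ} (ha : HP a) (hb : HP b) (hc : HP c)
    (h1 : det2 a b ≤ 0) (h2 : det2 b c ≤ 0) : det2 a c ≤ 0 := by
  unfold HP det2 at *
  rcases hb with hb | ⟨hb, hb'⟩
  · have : b.1 * (a.1 * c.2 - a.2 * c.1) ≤ 0 := by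
      have e : b.1 * (a.1 * c.2 - a.2 * c.1)
        = a.1 * (b.1 * c.2 - b.2 * c.1) + c.1 * (a.1 * b.2 - a.2 * b.1) := by ring
      have ha' : 0 ≤ a.1 := by rcases ha with h | h <;> linarith
      have hc' : 0 ≤ c.1 := by rcases hc with h | h <;> linarith
      rw [e]
      nlinarith [mul_nonneg ha' (neg_nonneg.2 h2), mul_nonneg hc' (neg_nonneg.2 h1)]
    by_contra hh
    push Not at hh
    nlinarith [mul_pos hb hh]
  · have ha' : 0 ≤ a.1 := by rcases ha with h | h <;> linarith
    have hc' : 0 ≤ c.1 := by rcases hc with h | h <;> linarith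
    rw [hb] at h1 h2
    have : a.1 = 0 := by nlinarith
    rw [this]
    rcases ha with ha | ha
    · linarith
    · nlinarith [mul_nonneg ha.2.le hc']

lemma HP_trans_lt {a b c : ℝ × ℝ} (ha : HP a) (hb : HP b) (hc : HP c)
    (h1 : det2 a b < 0) (h2 : det2 b c ≤ 0) : det2 a c < 0 := by
  by_contra h
  have h3 : det2 c a ≤ 0 := by unfold det2 at *; linarith
  have := HP_trans hb hc ha h2 h3
  unfold det2 at *; linarith

lemma HP_trans_lt' {a b c : ℝ × ℝ} (ha : HP a) (hb : HP b) (hc : HP c)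
    (h1 : det2 a b ≤ 0) (h2 : det2 b c < 0) : det2 a c < 0 := by
  by_contra h
  have h3 : det2 c a ≤ 0 := by unfold det2 at *; linarith
  have := HP_trans hc ha hb h3 h1
  unfold det2 at *; linarith

lemma det2_neg_left (a b : ℝ × ℝ) : det2 (-a) b = -det2 a b := by
  simp [det2]; ring
lemma det2_neg_right (a b : ℝ × ℝ) : det2 a (-b) = -det2 a b := by
  simp [det2]; ring
lemma det2_swap (a b : ℝ × ℝ) : det2 a b = -det2 b a := by
  simp [det2]; ring
lemma det2_add_right (a b c : ℝ × ℝ) : det2 a (b + c) = det2 a b + det2 a c := by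
  simp [det2]; ring
lemma det2_sub_right (a b c : ℝ × ℝ) : det2 a (b - c) = det2 a b - det2 a c := by
  simp [det2]; ring
lemma det2_add_left (a b c : ℝ × ℝ) : det2 (a + b) c = det2 a c + det2 b c := by
  simp [det2]; ring
lemma det2_sub_left (a b c : ℝ × ℝ) : det2 (a - b) c = det2 a c - det2 b c := by
  simp [det2]; ring
lemma det2_smul_left (t : ℝ) (a c : ℝ × ℝ) : det2 (t • a) c = t * det2 a c := by
  simp [det2]; ring
lemma det2_smul_right (t : ℝ) (a c : ℝ × ℝ) : det2 a (t • c) = t * det2 a c := by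
  simp [det2]; ring
lemma det2_self (a : ℝ × ℝ) : det2 a a = 0 := by simp [det2]; ring
lemma det2_zero_left (a : ℝ × ℝ) : det2 0 a = 0 := by simp [det2]
lemma det2_zero_right (a : ℝ × ℝ) : det2 a 0 = 0 := by simp [det2]

lemma det2_sum_right {ι : Type*} (s : Finset ι) (a : ℝ × ℝ) (f : ι → ℝ × ℝ) :
    det2 a (∑ i ∈ s, f i) = ∑ i ∈ s, det2 a (f i) := by
  classical
  induction s using Finset.induction_on with
  | empty => simp [det2_zero_right]
  | insert i s hi ih => rw [Finset.sum_insert hi, Finset.sum_insert hi, det2_add_right, ih]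

lemma det2_sum_left {ι : Type*} (s : Finset ι) (a : ℝ × ℝ) (f : ι → ℝ × ℝ) :
    det2 (∑ i ∈ s, f i) a = ∑ i ∈ s, det2 (f i) a := by
  rw [det2_swap, det2_sum_right, ← Finset.sum_neg_distrib]
  exact Finset.sum_congr rfl fun i _ => (det2_swap _ _).symm

/-- strict clockwise order of directions, starting from straight up -/
def clt (u w : ℝ × ℝ) : Prop :=
  (HP u ∧ HP (-w)) ∨ (HP u ∧ HP w ∧ det2 u w < 0) ∨ (HP (-u) ∧ HP (-w) ∧ det2 u w < 0)

lemma clt_not_both {u w : ℝ × ℝ} (h : clt u w) (h' : clt w u) : False := by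
  have := det2_swap u w
  rcases h with h | h | h <;> rcases h' with h' | h' | h'
  · exact HP_not_both h.1 h'.2
  · exact HP_not_both h'.1 h.2
  · exact HP_not_both h.1 h'.2.1
  · exact HP_not_both h.1 h'.2
  · linarith [h.2.2, h'.2.2]
  · exact HP_not_both h.1 h'.2.1
  · exact HP_not_both h'.1 h.2.1
  · exact HP_not_both h'.1 h.2.1
  · linarith [h.2.2, h'.2.2]

/-- not comparable implies det zero. -/
lemma clt_total {u w : ℝ × ℝ} (hu : u ≠ 0) (hw : w ≠ 0) (h : ¬ clt u w) (h' : ¬ clt w u) :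
    det2 u w = 0 := by
  unfold clt at *
  push Not at h h'
  have := det2_swap u w
  rcases HP_or_neg hu with a | a <;> rcases HP_or_neg hw with b | b
  · have := h.2.1 a b; have := h'.2.1 b a; linarith
  · exact absurd b (h.1 a)
  · exact absurd a (h'.1 b)
  · have := h.2.2 a b; have := h'.2.2 b a; linarith

lemma HPn_trans {a b c : ℝ × ℝ} (ha : HP (-a)) (hb : HP (-b)) (hc : HP (-c))
    (h1 : det2 a b ≤ 0) (h2 : det2 b c ≤ 0) : det2 a c ≤ 0 := by
  have := HP_trans ha hb hc (by simpa [det2_neg_left, det2_neg_right] using h1)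
    (by simpa [det2_neg_left, det2_neg_right] using h2)
  simpa [det2_neg_left, det2_neg_right] using this

/-- negative transitivity -/
lemma clt_neg_trans {x y u : ℝ × ℝ} (hy : y ≠ 0) (h : clt x u) (hyx : ¬ clt x y) :
    clt y u := by
  unfold clt at *
  push Not at hyx
  have s1 := det2_swap x u
  have s2 := det2_swap x y
  have s3 := det2_swap y u
  rcases h with h | h | h
  · rcases HP_or_neg hy with b | b
    · exact Or.inl ⟨b, h.2⟩
    · exact absurd b (hyx.1 h.1)
  · rcases HP_or_neg hy with b | b
    · refine Or.inr (Or.inl ⟨b, h.2.1, ?_⟩)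
      have := hyx.2.1 h.1 b
      exact HP_trans_lt' b h.1 h.2.1 (by linarith) h.2.2
    · exact absurd b (hyx.1 h.1)
  · rcases HP_or_neg hy with b | b
    · exact Or.inl ⟨b, h.2.1⟩
    · refine Or.inr (Or.inr ⟨b, h.2.1, ?_⟩)
      have := hyx.2.2 h.1 b
      by_contra h3
      have := HPn_trans h.2.1 b h.1 (by linarith) (by linarith)
      linarith [h.2.2]

/-! ### Cone facts -/

/-- same direction or strict right turn -/
def Turn (x y : ℝ × ℝ) : Prop := det2 x y < 0 ∨ ∃ c : ℝ, 0 < c ∧ y = c • x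

def InCone (x y u : ℝ × ℝ) : Prop := det2 x y < 0 ∧ det2 x u ≤ 0 ∧ det2 u y ≤ 0

lemma HP_smul {c : ℝ} (hc : 0 < c) {x : ℝ × ℝ} (h : HP x) : HP (c • x) := by
  unfold HP at *
  simp only [Prod.smul_fst, Prod.smul_snd, smul_eq_mul]
  rcases h with h | h
  · left; positivity
  · right; refine ⟨by simp [h.1], mul_pos hc h.2⟩

lemma cone_mid {x y u : ℝ × ℝ} (hu : u ≠ 0) (hx : x ≠ 0) (hy : y ≠ 0) (h1 : clt x u)
    (h2 : ¬ clt y u) (ht : Turn x y) : InCone x y u := by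
  have hxy : clt x y := by
    by_contra h
    exact h2 (clt_neg_trans hy h1 h)
  have s1 := det2_swap x u
  have s2 := det2_swap x y
  have s3 := det2_swap y u
  have hlt : det2 x y < 0 := by
    rcases ht with h | ⟨c, hc, rfl⟩
    · exact h
    · exfalso
      have h0 : det2 x (c • x) = 0 := by rw [det2_smul_right, det2_self, mul_zero]
      rcases hxy with h | h | h
      · have : HP (-(c • x)) := h.2
        exact HP_not_both (HP_smul hc h.1) this
      · linarith [h.2.2]
      · linarith [h.2.2]
  refine ⟨hlt, ?_, ?_⟩
  · rcases h1 with h | h | h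
    · by_contra hh
      -- x ∈ H, u ∈ -H, y must be in -H
      have hyn : HP (-y) := by
        rcases HP_or_neg hy with b | b
        · exact absurd (Or.inl ⟨b, h.2⟩) h2
        · exact b
      have huy : det2 u y ≤ 0 := by
        by_contra hc
        exact h2 (Or.inr (Or.inr ⟨hyn, h.2, by linarith⟩))
      have : det2 (-(-x)) (-y) ≤ 0 := by
        have e1 : det2 (- - -x) u ≤ 0 := by
          rw [neg_neg, det2_neg_left]; linarith
        have := HPn_trans (a := -x) (b := u) (c := y) (by simpa using h.1) h.2 hyn
          (by rw [det2_neg_left]; linarith) huy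
        rw [det2_neg_left] at this
        linarith
      have := HPn_trans (a := -x) (b := u) (c := y) (by simpa using h.1) h.2 hyn
          (by rw [det2_neg_left]; linarith) huy
      rw [det2_neg_left] at this
      linarith
    · exact h.2.2.le
    · exact h.2.2.le
  · by_contra hh
    push Not at hh
    have hyu : det2 y u < 0 := by linarith
    rcases HP_or_neg hy with b | b <;> rcases HP_or_neg hu with a | a
    · exact h2 (Or.inr (Or.inl ⟨b, a, hyu⟩))
    · exact h2 (Or.inl ⟨b, a⟩)
    · -- u ∈ H, y ∈ -H, x ∈ H, x before u
      rcases h1 with h | h | h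
      · exact HP_not_both a h.2
      · have := HP_trans_lt (a := x) (b := u) (c := -y) h.1 a b h.2.2
          (by rw [det2_neg_right]; linarith)
        rw [det2_neg_right] at this
        linarith
      · exact HP_not_both a h.2.1
    · exact h2 (Or.inr (Or.inr ⟨b, a, hyu⟩))

lemma turn_wrap {x y : ℝ × ℝ} (hx : HP (-x)) (hy : HP y) (ht : Turn x y) : det2 x y < 0 := by
  rcases ht with h | ⟨c, hc, rfl⟩
  · exact h
  · exfalso
    have := HP_smul (inv_pos.2 hc) hy
    rw [smul_smul, inv_mul_cancel₀ hc.ne', one_smul] at this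
    exact HP_not_both this hx

lemma cone_first {x y u : ℝ × ℝ} (hu : u ≠ 0) (hx : HP (-x)) (hy : HP y)
    (h2 : ¬ clt y u) (ht : Turn x y) : InCone x y u := by
  have hlt := turn_wrap hx hy ht
  have hHu : HP u := by
    rcases HP_or_neg hu with a | a
    · exact a
    · exact absurd (Or.inl ⟨hy, a⟩) h2
  have s3 := det2_swap y u
  have huy : det2 u y ≤ 0 := by
    by_contra hc
    exact h2 (Or.inr (Or.inl ⟨hy, hHu, by linarith⟩))
  refine ⟨hlt, ?_, huy⟩
  have := HP_trans hHu hy hx huy (by rw [det2_neg_right, ← det2_swap]; exact hlt.le)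
  rw [det2_neg_right, ← det2_swap] at this
  exact this

lemma cone_last {x y u : ℝ × ℝ} (hu : u ≠ 0) (hx : HP (-x)) (hy : HP y)
    (h2 : clt x u) (ht : Turn x y) : InCone x y u := by
  have hlt := turn_wrap hx hy ht
  rcases h2 with h | h | h
  · exact (HP_not_both h.1 hx).elim
  · exact (HP_not_both h.1 hx).elim
  · refine ⟨hlt, h.2.2.le, ?_⟩
    have := HP_trans (a := y) (b := -x) (c := -u) hy hx h.2.1
      (by rw [det2_neg_right, ← det2_swap]; exact hlt.le)
      (by rw [det2_neg_right, det2_neg_left, neg_neg]; exact h.2.2.le)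
    rw [det2_neg_right, ← det2_swap] at this
    exact this

lemma InCone.exists {x y u : ℝ × ℝ} (h : InCone x y u) :
    ∃ α β : ℝ, 0 ≤ α ∧ 0 ≤ β ∧ u = α • x + β • y := by
  obtain ⟨h1, h2, h3⟩ := h
  refine ⟨det2 u y / det2 x y, det2 x u / det2 x y, div_nonneg_of_nonpos h3 h1.le,
    div_nonneg_of_nonpos h2 h1.le, ?_⟩
  have := h1.ne
  ext
  · simp only [Prod.fst_add, Prod.smul_fst, smul_eq_mul]
    field_simp
    simp only [det2]; ring
  · simp only [Prod.snd_add, Prod.smul_snd, smul_eq_mul]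
    field_simp
    simp only [det2]; ring

/-! ### Polygons -/

def ClockPolygon.edge (Q : ClockPolygon) (i : ℕ) : ℝ × ℝ := Q.verts (i + 1) - Q.verts i

lemma ClockPolygon.per (Q : ClockPolygon) : Function.Periodic Q.verts Q.n := Q.periodic

lemma ClockPolygon.edge_per (Q : ClockPolygon) (i : ℕ) : Q.edge (i + Q.n) = Q.edge i := by
  unfold ClockPolygon.edge
  rw [add_right_comm, Q.periodic, Q.periodic]

lemma ClockPolygon.verts_mem (Q : ClockPolygon) (i : ℕ) : Q.verts i ∈ Q.body :=
  subset_convexHull _ _ ⟨i, rfl⟩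

lemma ClockPolygon.verts_eq (Q : ClockPolygon) {i j : ℕ} (h : Q.verts i = Q.verts j) :
    i % Q.n = j % Q.n := by
  apply Q.inj _ _ (Nat.mod_lt _ Q.npos) (Nat.mod_lt _ Q.npos)
  rw [Q.per.map_mod_nat, Q.per.map_mod_nat, h]

lemma exists_lexmin (S : Finset (ℝ × ℝ)) (hS : S.Nonempty) :
    ∃ p ∈ S, ∀ q ∈ S, q ≠ p → HP (q - p) := by
  obtain ⟨p, hp, h⟩ := S.exists_min_image toLex hS
  refine ⟨p, hp, fun q hq hne => ?_⟩
  have := h q hq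
  rw [Prod.Lex.le_iff] at this
  unfold HP
  simp only [ofLex_toLex, Prod.fst_sub, Prod.snd_sub] at *
  rcases this with h | ⟨h, h'⟩
  · left; linarith
  · right
    refine ⟨by linarith, ?_⟩
    rcases h'.lt_or_eq with h'' | h''
    · linarith
    · exact absurd (Prod.ext h.symm h''.symm) hne

lemma ClockPolygon.verts_mod_mem (Q : ClockPolygon) (i : ℕ) :
    Q.verts i ∈ (Finset.range Q.n).image Q.verts :=
  Finset.mem_image.2 ⟨i % Q.n, Finset.mem_range.2 (Nat.mod_lt _ Q.npos), Q.per.map_mod_nat i⟩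

lemma ClockPolygon.exists_lexmin (Q : ClockPolygon) :
    ∃ s, ∀ i, Q.verts i ≠ Q.verts s → HP (Q.verts i - Q.verts s) := by
  obtain ⟨p, hp, h⟩ := _root_.exists_lexmin ((Finset.range Q.n).image Q.verts)
    ⟨_, Q.verts_mod_mem 0⟩
  obtain ⟨s, -, rfl⟩ := Finset.mem_image.1 hp
  exact ⟨s, fun i hi => h _ (Q.verts_mod_mem i) hi⟩

def Good (Q : ClockPolygon) : Prop := ∀ i, Q.edge i ≠ 0 ∧ Turn (Q.edge i) (Q.edge (i + 1))

lemma sum_shift (n : ℕ) (g : ℕ → ℝ) (hg : ∀ i, g (i + n) = g i) (s : ℕ) :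
    ∑ i ∈ Finset.range n, g (s + i) = ∑ i ∈ Finset.range n, g i := by
  induction s with
  | zero => simp
  | succ s ih =>
    rw [← ih]
    have h1 := Finset.sum_range_succ (fun i => g (s + i)) n
    have h2 := Finset.sum_range_succ' (fun i => g (s + i)) n
    have h3 := hg s
    have h4 : ∑ i ∈ Finset.range n, g (s + 1 + i) = ∑ i ∈ Finset.range n, g (s + (i + 1)) :=
      Finset.sum_congr rfl fun i _ => by congr 1; omega
    simp only [add_zero] at h2
    linarith

open Classical in
def FF (Q : ClockPolygon) (s : ℕ) (u : ℝ × ℝ) : ℝ :=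
  det2 u (Q.verts s) + ∑ i ∈ Finset.range Q.n, if clt (Q.edge i) u then det2 u (Q.edge i) else 0

lemma good_two_le {Q : ClockPolygon} (hQ : Good Q) : 2 ≤ Q.n := by
  by_contra h
  have h1 : Q.n = 1 := by have := Q.npos; omega
  apply (hQ 0).1
  have := Q.periodic 0
  rw [h1] at this
  simp [ClockPolygon.edge, this]

lemma supp_core {Q : ClockPolygon} (hQ : Good Q) {s : ℕ}
    (hs : ∀ i, Q.verts i ≠ Q.verts s → HP (Q.verts i - Q.verts s)) {u : ℝ × ℝ} (hu : u ≠ 0) :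
    ∃ t, InCone (Q.edge t) (Q.edge (t + 1)) u ∧ FF Q s u = det2 u (Q.verts (t + 1)) := by
  classical
  have hn := good_two_le hQ
  have hsort : ∀ i, i + 1 < Q.n → ¬ clt (Q.edge (s + (i + 1))) (Q.edge (s + i)) := by
    intro i hi hc
    have hT := (hQ (s + i)).2
    rw [show s + i + 1 = s + (i + 1) by ring] at hT
    have hsame : ¬ det2 (Q.edge (s + (i + 1))) (Q.edge (s + i)) < 0 := by
      intro h
      rcases hT with h' | ⟨c, hc, h'⟩
      · have := det2_swap (Q.edge (s + (i + 1))) (Q.edge (s + i)); linarith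
      · rw [h', det2_smul_left, det2_self, mul_zero] at h; linarith
    rcases hc with h | h | h
    · have hlt := turn_wrap h.2 h.1 hT
      have hne : Q.verts (s + (i + 1)) ≠ Q.verts s := by
        intro h'
        have h1 := Q.verts_eq h'
        have h2 : s + (i + 1) ≡ s + 0 [MOD Q.n] := h1
        have h3 := Nat.ModEq.add_left_cancel' s h2
        have h4 := Nat.ModEq.eq_of_lt_of_lt h3 hi (by omega)
        omega
      have hz := hs _ hne
      have h5 := Q.clockwise (s + (i + 1)) _ (Q.verts_mem s)
      have h6 := Q.clockwise (s + i) _ (Q.verts_mem s)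
      change det2 (Q.edge (s + (i + 1))) _ ≤ 0 at h5
      change det2 (Q.edge (s + i)) _ ≤ 0 at h6
      have h7 : Q.verts s - Q.verts (s + i) =
        -(Q.verts (s + (i + 1)) - Q.verts s) + Q.edge (s + i) := by
        unfold ClockPolygon.edge
        rw [show s + i + 1 = s + (i + 1) by ring]; abel
      rw [h7, det2_add_right, det2_self, add_zero, det2_neg_right] at h6
      rw [← neg_sub, det2_neg_right] at h5
      have := HP_trans h.2 hz h.1 (by rw [det2_neg_left]; exact h6)
        (by rw [det2_swap]; exact h5)
      rw [det2_neg_left] at this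
      linarith
    · exact hsame h.2.2
    · exact hsame h.2.2
  have hanti : ∀ i, i + 1 < Q.n → clt (Q.edge (s + (i + 1))) u → clt (Q.edge (s + i)) u :=
    fun i hi h => clt_neg_trans (hQ _).1 h (hsort i hi)
  have hex : ∃ m, Q.n ≤ m ∨ ¬ clt (Q.edge (s + m)) u := ⟨Q.n, Or.inl le_rfl⟩
  obtain ⟨m, hmn, hm1, hm2⟩ : ∃ m, m ≤ Q.n ∧ (∀ i < m, clt (Q.edge (s + i)) u) ∧
      ∀ i, m ≤ i → i < Q.n → ¬ clt (Q.edge (s + i)) u := by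
    refine ⟨Nat.find hex, Nat.find_min' hex (Or.inl le_rfl), fun i hi => ?_, ?_⟩
    · have := Nat.find_min hex hi
      push Not at this
      exact this.2
    · intro i hi
      induction i, hi using Nat.le_induction with
      | base =>
        intro h
        rcases Nat.find_spec hex with h' | h'
        · omega
        · exact h'
      | succ i hi ih =>
        intro h hc
        exact ih (by omega) (hanti i h hc)
  have hF : FF Q s u = det2 u (Q.verts (s + m)) := by
    unfold FF
    rw [← sum_shift Q.n _ (fun i => by simp only [Q.edge_per]) s]
    have h1 : ∑ i ∈ Finset.range Q.n,
        (if clt (Q.edge (s + i)) u then det2 u (Q.edge (s + i)) else 0)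
        = ∑ i ∈ Finset.range m, det2 u (Q.edge (s + i)) := by
      rw [← Finset.sum_range_add_sum_Ico _ hmn]
      rw [Finset.sum_congr rfl (fun i hi => if_pos (hm1 i (Finset.mem_range.1 hi)))]
      rw [Finset.sum_eq_zero (s := Finset.Ico m Q.n), add_zero]
      intro i hi
      rw [Finset.mem_Ico] at hi
      exact if_neg (hm2 i hi.1 hi.2)
    rw [h1]
    have h2 : ∑ i ∈ Finset.range m, det2 u (Q.edge (s + i))
      = det2 u (Q.verts (s + m)) - det2 u (Q.verts (s + 0)) := by
      rw [← Finset.sum_range_sub (fun i => det2 u (Q.verts (s + i)))]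
      refine Finset.sum_congr rfl fun i _ => ?_
      rw [← det2_sub_right]; rfl
    rw [h2]; simp
  have hne1 : Q.verts (s + 1) ≠ Q.verts s := sub_ne_zero.1 (hQ s).1
  have hfirst : HP (Q.edge s) := hs _ hne1
  have hlast : HP (-Q.edge (s + Q.n - 1)) := by
    have h1 : Q.verts (s + Q.n - 1 + 1) = Q.verts s := by
      rw [show s + Q.n - 1 + 1 = s + Q.n by omega, Q.periodic]
    have h2 := (hQ (s + Q.n - 1)).1
    unfold ClockPolygon.edge at *
    rw [h1] at h2 ⊢
    rw [neg_sub]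
    exact hs _ (sub_ne_zero.1 h2).symm
  have hwrap : Q.edge (s + Q.n - 1 + 1) = Q.edge s := by
    rw [show s + Q.n - 1 + 1 = s + Q.n by omega, Q.edge_per]
  have hT := (hQ (s + Q.n - 1)).2
  rcases Nat.eq_zero_or_pos m with h0 | h0
  · subst h0
    refine ⟨s + Q.n - 1, ?_, ?_⟩
    · rw [hwrap] at hT ⊢
      exact cone_first hu hlast hfirst (hm2 0 le_rfl (by omega)) hT
    · rw [hF, show s + Q.n - 1 + 1 = s + 0 + Q.n by omega, Q.periodic]
  · refine ⟨s + m - 1, ?_, by rw [hF, show s + m - 1 + 1 = s + m by omega]⟩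
    rcases hmn.lt_or_eq with h | h
    · have e1 : s + m - 1 = s + (m - 1) := by omega
      have := (hQ (s + m - 1)).2
      refine cone_mid hu (hQ _).1 (hQ _).1 ?_ ?_ this
      · rw [e1]; exact hm1 _ (by omega)
      · rw [show s + m - 1 + 1 = s + m by omega]; exact hm2 m le_rfl h
    · subst h
      rw [hwrap] at hT ⊢
      refine cone_last hu hlast hfirst ?_ hT
      rw [show s + Q.n - 1 = s + (Q.n - 1) by omega]
      exact hm1 _ (by omega)

lemma good_cone {Q : ClockPolygon} (hQ : Good Q) {u : ℝ × ℝ} (hu : u ≠ 0) :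
    ∃ t, InCone (Q.edge t) (Q.edge (t + 1)) u := by
  obtain ⟨s, hs⟩ := Q.exists_lexmin
  obtain ⟨t, ht, -⟩ := supp_core hQ hs hu
  exact ⟨t, ht⟩

lemma clock' (Q : ClockPolygon) (i : ℕ) {q : ℝ × ℝ} (hq : q ∈ Q.body) :
    det2 (Q.edge i) q ≤ det2 (Q.edge i) (Q.verts i) := by
  have := Q.clockwise i q hq
  rw [det2_sub_right] at this
  exact sub_nonpos.1 this

lemma det2_edge_succ (Q : ClockPolygon) (i : ℕ) :
    det2 (Q.edge i) (Q.verts (i + 1)) = det2 (Q.edge i) (Q.verts i) := by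
  have : Q.verts (i + 1) = Q.verts i + Q.edge i := by simp [ClockPolygon.edge]
  rw [this, det2_add_right, det2_self, add_zero]

lemma omegaLen_eq_of_max {K : Set (ℝ × ℝ)} {u p : ℝ × ℝ} (hp : p ∈ K)
    (h : ∀ q ∈ K, det2 u q ≤ det2 u p) : omegaLen K u = det2 u p := by
  apply IsGreatest.csSup_eq
  refine ⟨⟨p, hp, rfl⟩, ?_⟩
  rintro _ ⟨q, hq, rfl⟩
  exact h q hq

lemma supp_eq {Q : ClockPolygon} (hQ : Good Q) {s : ℕ}
    (hs : ∀ i, Q.verts i ≠ Q.verts s → HP (Q.verts i - Q.verts s)) {u : ℝ × ℝ} (hu : u ≠ 0) :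
    omegaLen Q.body u = FF Q s u := by
  obtain ⟨t, ht, h⟩ := supp_core hQ hs hu
  rw [h]
  obtain ⟨α, β, hα, hβ, rfl⟩ := ht.exists
  apply omegaLen_eq_of_max (Q.verts_mem _)
  intro q hq
  have h1 := clock' Q t hq
  have h2 := clock' Q (t + 1) hq
  rw [← det2_edge_succ] at h1
  simp only [det2_add_left, det2_smul_left]
  nlinarith [mul_le_mul_of_nonneg_left h1 hα, mul_le_mul_of_nonneg_left h2 hβ]

lemma sum_edge (Q : ClockPolygon) : ∑ i ∈ Finset.range Q.n, Q.edge i = 0 := by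
  unfold ClockPolygon.edge
  rw [Finset.sum_range_sub]
  have := Q.periodic 0
  rw [zero_add] at this
  rw [this, sub_self]

lemma omegaPerim_eq (K : Set (ℝ × ℝ)) (Q : ClockPolygon) :
    omegaPerim K Q = ∑ i ∈ Finset.range Q.n, omegaLen K (Q.edge i) := rfl

lemma perim_symm {A B : ClockPolygon} (hA : Good A) (hB : Good B) :
    omegaPerim A.body B = omegaPerim B.body A := by
  classical
  obtain ⟨s, hs⟩ := A.exists_lexmin
  obtain ⟨r, hr⟩ := B.exists_lexmin
  rw [omegaPerim_eq, omegaPerim_eq]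
  rw [Finset.sum_congr rfl fun i _ => supp_eq hA hs (hB i).1,
    Finset.sum_congr rfl fun i _ => supp_eq hB hr (hA i).1]
  unfold FF
  rw [Finset.sum_add_distrib, Finset.sum_add_distrib, ← det2_sum_left, ← det2_sum_left,
    sum_edge, sum_edge, det2_zero_left, det2_zero_left, zero_add, zero_add]
  rw [Finset.sum_comm (s := Finset.range A.n), ← sub_eq_zero, ← Finset.sum_sub_distrib]
  simp_rw [← Finset.sum_sub_distrib]
  have : ∑ i ∈ Finset.range B.n, ∑ j ∈ Finset.range A.n, det2 (B.edge i) (A.edge j) = 0 := by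
    simp_rw [← det2_sum_right, sum_edge, det2_zero_right, Finset.sum_const_zero]
  refine Eq.trans (Finset.sum_congr rfl fun i _ => Finset.sum_congr rfl fun j _ => ?_) this
  have sw := det2_swap (B.edge i) (A.edge j)
  by_cases h1 : clt (A.edge j) (B.edge i)
  · by_cases h2 : clt (B.edge i) (A.edge j)
    · exact (clt_not_both h1 h2).elim
    · simp [h1, h2]
  · by_cases h2 : clt (B.edge i) (A.edge j)
    · simp only [h1, h2, if_true, if_false]; linarith
    · simp [h1, h2, clt_total (hB i).1 (hA j).1 h2 h1]

/-! ### Segments -/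

lemma omegaLen_zero {K : Set (ℝ × ℝ)} (hK : K.Nonempty) : omegaLen K 0 = 0 := by
  obtain ⟨p, hp⟩ := hK
  rw [omegaLen_eq_of_max hp (by simp [det2_zero_left]), det2_zero_left]

lemma body_ne (Q : ClockPolygon) : Q.body.Nonempty := ⟨_, Q.verts_mem 0⟩

lemma width_eq {P : ClockPolygon} (hP : Good P) (d : ℝ × ℝ) :
    omegaLen P.body d + omegaLen P.body (-d) =
      ∑ j ∈ Finset.range P.n, max 0 (det2 (P.edge j) d) := by
  classical
  by_cases hd : d = 0
  · subst hd
    simp [omegaLen_zero (body_ne P), det2_zero_right]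
  wlog hH : HP d generalizing d with hw
  · have hn := (HP_or_neg hd).resolve_left hH
    have := hw (-d) (neg_ne_zero.2 hd) hn
    rw [neg_neg, add_comm] at this
    rw [this]
    have h0 : ∑ j ∈ Finset.range P.n, det2 (P.edge j) d = 0 := by
      rw [← det2_sum_left, sum_edge, det2_zero_left]
    rw [← sub_eq_zero, ← Finset.sum_sub_distrib, ← neg_eq_zero, ← Finset.sum_neg_distrib]
    refine Eq.trans (Finset.sum_congr rfl fun j _ => ?_) h0
    rw [det2_neg_right]
    rcases le_total 0 (det2 (P.edge j) d) with h | h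
    · rw [max_eq_left (by linarith), max_eq_right h]; ring
    · rw [max_eq_right (by linarith), max_eq_left h]; ring
  obtain ⟨s, hs⟩ := P.exists_lexmin
  rw [supp_eq hP hs hd, supp_eq hP hs (neg_ne_zero.2 hd)]
  unfold FF
  rw [det2_neg_left, add_add_add_comm, add_neg_cancel, zero_add, ← Finset.sum_add_distrib]
  refine Finset.sum_congr rfl fun j _ => ?_
  have hf := (hP j).1
  have hnd : ¬ HP (-d) := fun h => HP_not_both hH h
  have sw := det2_swap (P.edge j) d
  rcases HP_or_neg hf with h | h
  · have h2 : ¬ HP (-P.edge j) := fun h' => HP_not_both h h'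
    have e1 : clt (P.edge j) (-d) := Or.inl ⟨h, by simpa using hH⟩
    rw [if_pos e1, det2_neg_left]
    by_cases hc : det2 (P.edge j) d < 0
    · rw [if_pos (show clt (P.edge j) d from Or.inr (Or.inl ⟨h, hH, hc⟩)), max_eq_left hc.le]; ring
    · rw [if_neg (by unfold clt; tauto), max_eq_right (by linarith)]; linarith
  · have h2 : ¬ HP (P.edge j) := fun h' => HP_not_both h' h
    rw [if_neg (c := clt (P.edge j) d) (by unfold clt; tauto), zero_add]
    by_cases hc : det2 (P.edge j) (-d) < 0
    · rw [if_pos (show clt (P.edge j) (-d) from Or.inr (Or.inr ⟨h, by simpa using hH, hc⟩)), det2_neg_left]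
      rw [det2_neg_right] at hc
      rw [max_eq_right (by linarith)]; linarith
    · rw [if_neg (by unfold clt; tauto)]
      rw [det2_neg_right] at hc
      rw [max_eq_left (by linarith)]

/-! ### Collinear polygons -/

lemma exists_smul_of_det {x y : ℝ × ℝ} (hx : x ≠ 0) (h : det2 x y = 0) : ∃ c : ℝ, y = c • x := by
  unfold det2 at h
  by_cases h1 : x.1 = 0
  · have h2 : x.2 ≠ 0 := fun h2 => hx (Prod.ext h1 h2)
    refine ⟨y.2 / x.2, Prod.ext ?_ ?_⟩
    · rw [h1] at h
      have : y.1 = 0 := by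
        have : x.2 * y.1 = 0 := by linarith
        exact (mul_eq_zero.1 this).resolve_left h2
      simp [this, h1]
    · simp [h2]
  · refine ⟨y.1 / x.1, Prod.ext ?_ ?_⟩
    · simp [h1]
    · simp only [Prod.smul_snd, smul_eq_mul]
      field_simp
      linarith

lemma HP_smul_pos {x y : ℝ × ℝ} (hx : HP x) (hy : HP y) (h : det2 x y = 0) :
    ∃ c : ℝ, 0 < c ∧ y = c • x := by
  obtain ⟨c, rfl⟩ := exists_smul_of_det (HP_ne hx) h
  refine ⟨c, ?_, rfl⟩
  rcases lt_trichotomy c 0 with hc | hc | hc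
  · have := HP_smul (neg_pos.2 hc) hx
    rw [neg_smul] at this
    exact (HP_not_both hy this).elim
  · subst hc; exact absurd (zero_smul ℝ x) (HP_ne hy)
  · exact hc

lemma range_verts (Q : ClockPolygon) :
    Set.range Q.verts = ((Finset.range Q.n).image Q.verts : Finset (ℝ × ℝ)) := by
  ext p
  constructor
  · rintro ⟨i, rfl⟩
    exact Q.verts_mod_mem i
  · intro h
    obtain ⟨i, -, rfl⟩ := Finset.mem_image.1 (Finset.mem_coe.1 h)
    exact ⟨i, rfl⟩

lemma body_compact (Q : ClockPolygon) : IsCompact Q.body := by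
  unfold ClockPolygon.body
  rw [range_verts]
  exact (Finset.finite_toSet _).isCompact_convexHull ℝ

lemma det2_cont (u : ℝ × ℝ) : Continuous (det2 u) := by
  unfold det2; fun_prop

lemma det2_lin (u : ℝ × ℝ) : IsLinearMap ℝ (det2 u) :=
  ⟨det2_add_right u, fun c x => det2_smul_right c u x⟩

lemma omegaLen_attained {K : Set (ℝ × ℝ)} (hK : IsCompact K) (hne : K.Nonempty) (u : ℝ × ℝ) :
    ∃ w ∈ K, omegaLen K u = det2 u w ∧ ∀ q ∈ K, det2 u q ≤ det2 u w := by
  obtain ⟨w, hw, h⟩ := hK.exists_isMaxOn hne (det2_cont u).continuousOn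
  exact ⟨w, hw, omegaLen_eq_of_max hw h, h⟩

lemma le_omegaLen {K : Set (ℝ × ℝ)} (hK : IsCompact K) (u : ℝ × ℝ) {q : ℝ × ℝ} (hq : q ∈ K) :
    det2 u q ≤ omegaLen K u := by
  obtain ⟨w, _, h, h'⟩ := omegaLen_attained hK ⟨q, hq⟩ u
  rw [h]; exact h' q hq

def Coll (Q : ClockPolygon) : Prop := ∃ e p : ℝ × ℝ, e ≠ 0 ∧ ∀ q ∈ Q.body, det2 e (q - p) = 0

lemma good_or_coll (Q : ClockPolygon) : Good Q ∨ Coll Q := by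
  by_cases hn : Q.n = 1
  · right
    refine ⟨(1, 0), Q.verts 0, by simp, fun q hq => ?_⟩
    have : Q.body = {Q.verts 0} := by
      unfold ClockPolygon.body
      have h : Set.range Q.verts = {Q.verts 0} := by
        rw [range_verts, hn]; simp
      rw [h, convexHull_singleton]
    rw [this, Set.mem_singleton_iff] at hq
    rw [hq, sub_self, det2_zero_right]
  have hne : ∀ i, Q.edge i ≠ 0 := by
    intro i h
    have h1 := Q.verts_eq (sub_eq_zero.1 h)
    have h2 : i + 1 ≡ i + 0 [MOD Q.n] := h1
    have h3 := Nat.ModEq.add_left_cancel' i h2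
    have := (Nat.modEq_zero_iff_dvd.1 h3)
    exact hn (Nat.dvd_one.1 this)
  by_cases hg : ∀ i, Turn (Q.edge i) (Q.edge (i + 1))
  · exact Or.inl fun i => ⟨hne i, hg i⟩
  right
  push Not at hg
  obtain ⟨i, hi⟩ := hg
  refine ⟨Q.edge i, Q.verts i, hne i, ?_⟩
  have h1 : det2 (Q.edge i) (Q.edge (i + 1)) ≤ 0 := by
    have := clock' Q i (Q.verts_mem (i + 2))
    rw [← det2_edge_succ] at this
    have h2 : Q.edge (i + 1) = Q.verts (i + 2) - Q.verts (i + 1) := rfl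
    rw [h2, det2_sub_right]; linarith
  have h0 : det2 (Q.edge i) (Q.edge (i + 1)) = 0 := by
    by_contra h
    exact hi (Or.inl (lt_of_le_of_ne h1 h))
  obtain ⟨c, hc⟩ := exists_smul_of_det (hne i) h0
  have hcn : c < 0 := by
    by_contra h
    rcases (not_lt.1 h).lt_or_eq with h | h
    · exact hi (Or.inr ⟨c, h, hc⟩)
    · exact hne (i + 1) (by rw [hc, ← h, zero_smul])
  intro q hq
  have a1 := clock' Q i hq
  have a2 := clock' Q (i + 1) hq
  rw [hc, det2_smul_left, det2_smul_left, det2_edge_succ] at a2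
  rw [det2_sub_right]
  nlinarith

lemma coll_segment {Q : ClockPolygon} (hQ : Coll Q) :
    ∃ s r, Q.body ⊆ segment ℝ (Q.verts s) (Q.verts r) := by
  obtain ⟨e, p, he, h⟩ := hQ
  obtain ⟨s, hs⟩ := Q.exists_lexmin
  obtain ⟨r, hr⟩ : ∃ r, ∀ i, Q.verts i ≠ Q.verts r → HP (Q.verts r - Q.verts i) := by
    obtain ⟨m, hm, h⟩ := _root_.exists_lexmin
      (((Finset.range Q.n).image Q.verts).image (fun x => -x)) ⟨_, Finset.mem_image_of_mem _
        (Q.verts_mod_mem 0)⟩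
    obtain ⟨m', hm', rfl⟩ := Finset.mem_image.1 hm
    obtain ⟨r, -, rfl⟩ := Finset.mem_image.1 hm'
    refine ⟨r, fun i hi => ?_⟩
    have := h _ (Finset.mem_image_of_mem _ (Q.verts_mod_mem i)) (by simpa using hi)
    rwa [neg_sub_neg] at this
  refine ⟨s, r, convexHull_min ?_ (convex_segment _ _)⟩
  rintro _ ⟨i, rfl⟩
  by_cases h1 : Q.verts i = Q.verts s
  · rw [h1]; exact left_mem_segment _ _ _
  by_cases h2 : Q.verts i = Q.verts r
  · rw [h2]; exact right_mem_segment _ _ _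
  have e0 := h _ (Q.verts_mem i)
  have e1 := h _ (Q.verts_mem s)
  have e2 := h _ (Q.verts_mem r)
  obtain ⟨c, hc⟩ := exists_smul_of_det (x := e) (y := Q.verts i - Q.verts s) he (by
    rw [det2_sub_right] at *; linarith)
  obtain ⟨c', hc'⟩ := exists_smul_of_det (x := e) (y := Q.verts r - Q.verts i) he (by
    rw [det2_sub_right] at *; linarith)
  obtain ⟨b, hb, hb'⟩ := HP_smul_pos (hs i h1) (hr i h2) (by
    rw [hc, hc', det2_smul_left, det2_smul_right, det2_self]; ring)
  refine ⟨b / (1 + b), 1 / (1 + b), by positivity, by positivity, by field_simp; ring, ?_⟩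
  have : Q.verts r = Q.verts i + b • (Q.verts i - Q.verts s) := by rw [← hb']; abel
  rw [this]
  ext
  · simp; field_simp; ring
  · simp; field_simp; ring

lemma seg_le (P : ClockPolygon) {K : Set (ℝ × ℝ)} (hK : IsCompact K) {a b : ℝ × ℝ}
    (ha : a ∈ K) (hb : b ∈ K) :
    ∑ j ∈ Finset.range P.n, max 0 (det2 (P.edge j) (b - a)) ≤ omegaPerim K P := by
  have h0 : ∑ j ∈ Finset.range P.n, det2 (P.edge j) a = 0 := by
    rw [← det2_sum_left, sum_edge, det2_zero_left]
  rw [← add_zero (∑ j ∈ Finset.range P.n, _), ← h0, ← Finset.sum_add_distrib, omegaPerim_eq, h0]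
  refine Finset.sum_le_sum fun j _ => ?_
  have h1 := le_omegaLen hK (P.edge j) ha
  have h2 := le_omegaLen hK (P.edge j) hb
  rw [det2_sub_right]
  rcases max_cases 0 (det2 (P.edge j) b - det2 (P.edge j) a) with h | h <;> linarith

lemma le_seg (P : ClockPolygon) {K : Set (ℝ × ℝ)} (hK : IsCompact K) (hne : K.Nonempty)
    {a b : ℝ × ℝ} (h : K ⊆ segment ℝ a b) :
    omegaPerim K P ≤ ∑ j ∈ Finset.range P.n, max 0 (det2 (P.edge j) (b - a)) := by
  have h0 : ∑ j ∈ Finset.range P.n, det2 (P.edge j) a = 0 := by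
    rw [← det2_sum_left, sum_edge, det2_zero_left]
  rw [← add_zero (∑ j ∈ Finset.range P.n, max _ _), ← h0, ← Finset.sum_add_distrib,
    omegaPerim_eq, h0]
  refine Finset.sum_le_sum fun j _ => ?_
  obtain ⟨w, hw, e, -⟩ := omegaLen_attained hK hne (P.edge j)
  rw [e]
  obtain ⟨x, y, hx, hy, hxy, rfl⟩ := h hw
  rw [det2_sub_right, det2_add_right, det2_smul_right, det2_smul_right]
  have hx' : x = 1 - y := by linarith
  subst hx'
  rcases max_cases 0 (det2 (P.edge j) b - det2 (P.edge j) a) with h | h <;> nlinarith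

lemma perim_path {P : ClockPolygon} (Q : ClockPolygon) (s r : ℕ) :
    omegaLen P.body (Q.verts r - Q.verts s) + omegaLen P.body (-(Q.verts r - Q.verts s))
      ≤ omegaPerim P.body Q := by
  obtain ⟨w, hw, e, -⟩ := omegaLen_attained (body_compact P) (body_ne P) (Q.verts r - Q.verts s)
  obtain ⟨w', hw', e', -⟩ :=
    omegaLen_attained (body_compact P) (body_ne P) (-(Q.verts r - Q.verts s))
  rw [e, e', omegaPerim_eq]
  obtain ⟨m, hm, hr⟩ : ∃ m < Q.n, Q.verts r = Q.verts (s + m) := by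
    have hp : Function.Periodic (fun i => Q.verts (s + i)) Q.n := fun i => by
      simp only [← add_assoc]; exact Q.periodic _
    refine ⟨(r + s * Q.n - s) % Q.n, Nat.mod_lt _ Q.npos, ?_⟩
    have h1 := hp.map_mod_nat (r + s * Q.n - s)
    rw [h1]
    have h2 : s ≤ s * Q.n := Nat.le_mul_of_pos_right _ Q.npos
    rw [show s + (r + s * Q.n - s) = r + s * Q.n by omega]
    exact ((Q.per.nat_mul s) r).symm
  rw [← sum_shift Q.n _ (fun i => by simp only [Q.edge_per]) s,
    ← Finset.sum_range_add_sum_Ico _ hm.le]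
  have t1 : ∑ i ∈ Finset.range m, Q.edge (s + i) = Q.verts r - Q.verts s := by
    have := Finset.sum_range_sub (fun i => Q.verts (s + i)) m
    rw [hr]; simpa [ClockPolygon.edge, add_assoc] using this
  have t2 : ∑ i ∈ Finset.Ico m Q.n, Q.edge (s + i) = -(Q.verts r - Q.verts s) := by
    have := Finset.sum_Ico_sub (fun i => Q.verts (s + i)) hm.le
    rw [hr]; simpa [ClockPolygon.edge, add_assoc, Q.periodic] using this
  rw [← t2, ← t1, det2_sum_left, det2_sum_left]
  exact add_le_add (Finset.sum_le_sum fun i _ => le_omegaLen (body_compact P) _ hw)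
    (Finset.sum_le_sum fun i _ => le_omegaLen (body_compact P) _ hw')

lemma perim_ge {P : ClockPolygon} (hP : Good P) (Q : ClockPolygon) :
    omegaPerim Q.body P ≤ omegaPerim P.body Q := by
  rcases good_or_coll Q with h | h
  · exact (perim_symm h hP).le
  · obtain ⟨s, r, hsr⟩ := coll_segment h
    refine (le_seg P (body_compact Q) (body_ne Q) hsr).trans ?_
    rw [← width_eq hP]
    exact perim_path Q s r

/-! ### Constructing polygons -/

lemma mkPoly (n : ℕ) (hn : 0 < n) (C : ℕ → ℝ × ℝ)
    (inj : ∀ i j, i < n → j < n → C i = C j → i = j)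
    (tri : ∀ i j k, i < j → j < k → k < n → det2 (C j - C i) (C k - C i) ≤ 0) :
    ∃ Q : ClockPolygon, Q.n = n ∧ ∀ i, Q.verts i = C (i % n) := by
  refine ⟨⟨n, hn, fun i => C (i % n), fun i => by simp, ?_, ?_⟩, rfl, fun i => rfl⟩
  · intro i j hi hj h
    simp only [Nat.mod_eq_of_lt hi, Nat.mod_eq_of_lt hj] at h
    exact inj i j hi hj h
  · intro i q hq
    have key : ∀ k, det2 (C ((i + 1) % n) - C (i % n)) (C (k % n) - C (i % n)) ≤ 0 := by
      intro k
      have hk := Nat.mod_lt k hn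
      have hi := Nat.mod_lt i hn
      set x := i % n with hx
      set y := k % n
      have hs : (i + 1) % n = (x + 1) % n := by rw [hx, Nat.mod_add_mod]
      rw [hs]
      rcases lt_or_eq_of_le (Nat.succ_le_of_lt hi) with h | h
      · rw [Nat.mod_eq_of_lt h]
        rcases lt_trichotomy y x with h1 | h1 | h1
        · have := tri y x (x + 1) h1 (by omega) h
          simp only [det2, Prod.fst_sub, Prod.snd_sub] at *
          linarith
        · rw [h1, sub_self, det2_zero_right]
        · rcases eq_or_lt_of_le (Nat.succ_le_of_lt h1) with h2 | h2
          · rw [← h2, Nat.succ_eq_add_one, det2_self]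
          · exact tri x (x + 1) y (by omega) h2 hk
      · rw [← Nat.succ_eq_add_one, h, Nat.mod_self]
        rcases Nat.eq_zero_or_pos y with h1 | h1
        · rw [h1, det2_self]
        · rcases lt_or_eq_of_le (show y ≤ x by omega) with h2 | h2
          · have := tri 0 y x h1 h2 hi
            simp only [det2, Prod.fst_sub, Prod.snd_sub] at *
            linarith
          · rw [h2, sub_self, det2_zero_right]
    have hconv : Convex ℝ {z | det2 (C ((i + 1) % n) - C (i % n)) z
        ≤ det2 (C ((i + 1) % n) - C (i % n)) (C (i % n))} :=
      convex_halfSpace_le (det2_lin _) _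
    have : q ∈ {z | det2 (C ((i + 1) % n) - C (i % n)) z
        ≤ det2 (C ((i + 1) % n) - C (i % n)) (C (i % n))} := by
      refine convexHull_min ?_ hconv hq
      rintro _ ⟨k, rfl⟩
      have := key k
      rw [det2_sub_right] at this
      exact sub_nonpos.1 this
    rw [det2_sub_right]
    exact sub_nonpos.2 this

lemma exists_minimal_hull (S : Finset (ℝ × ℝ)) :
    ∃ T ⊆ S, convexHull ℝ (T : Set (ℝ × ℝ)) = convexHull ℝ (S : Set (ℝ × ℝ)) ∧
      ∀ t ∈ T, t ∉ convexHull ℝ ((T.erase t : Finset (ℝ × ℝ)) : Set (ℝ × ℝ)) := by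
  classical
  obtain ⟨T, hT, hmin⟩ := (S.powerset.filter fun T : Finset (ℝ × ℝ) =>
    convexHull ℝ (T : Set (ℝ × ℝ)) = convexHull ℝ (S : Set (ℝ × ℝ))).exists_min_image
      Finset.card ⟨S, by simp⟩
  simp only [Finset.mem_filter, Finset.mem_powerset] at hT hmin
  refine ⟨T, hT.1, hT.2, fun t ht hc => ?_⟩
  have := hmin (T.erase t) ⟨(Finset.erase_subset _ _).trans hT.1, ?_⟩
  · have h2 := Finset.card_erase_lt_of_mem ht
    omega
  · rw [← hT.2]
    apply subset_antisymm
    · exact convexHull_mono (by exact_mod_cast Finset.erase_subset _ _)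
    · refine convexHull_min ?_ (convex_convexHull _ _)
      intro x hx
      by_cases h : x = t
      · rw [h]; exact hc
      · exact subset_convexHull _ _ (by simpa [h] using hx)

lemma exists_sorted (p : ℝ × ℝ) (U : Finset (ℝ × ℝ)) (hU : ∀ x ∈ U, HP (x - p)) :
    ∃ l : List (ℝ × ℝ), l.Nodup ∧ (∀ x, x ∈ l ↔ x ∈ U) ∧
      l.Pairwise (fun x y => det2 (x - p) (y - p) ≤ 0) := by
  classical
  let A := {x : ℝ × ℝ // HP (x - p)}
  let r : A → A → Prop := fun x y => det2 (x.1 - p) (y.1 - p) ≤ 0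
  have : Std.Total r := ⟨fun x y => by
    have := det2_swap (x.1 - p) (y.1 - p)
    rcases le_total (det2 (x.1 - p) (y.1 - p)) 0 with h | h
    · exact Or.inl h
    · right; change _ ≤ _; linarith⟩
  have : IsTrans A r := ⟨fun x y z h h' => HP_trans x.2 y.2 z.2 h h'⟩
  let l0 : List A := U.attach.toList.map (fun x => ⟨x.1, hU x.1 x.2⟩)
  have hl0 : l0.Nodup := by
    refine List.Nodup.map ?_ (Finset.nodup_toList _)
    intro x y h
    have h' := congrArg (fun a : A => a.1) h
    exact Subtype.ext h'
  refine ⟨(l0.insertionSort r).map Subtype.val, ?_, ?_, ?_⟩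
  · refine List.Nodup.map Subtype.val_injective ?_
    exact (List.perm_insertionSort r l0).nodup_iff.2 hl0
  · intro x
    simp only [List.mem_map, (List.perm_insertionSort r l0).mem_iff]
    constructor
    · rintro ⟨a, ha, rfl⟩
      obtain ⟨b, -, rfl⟩ := List.mem_map.1 ha
      exact b.2
    · intro hx
      exact ⟨⟨x, hU x hx⟩, List.mem_map.2 ⟨⟨x, hx⟩, by simp, rfl⟩, rfl⟩
  · rw [List.pairwise_map]
    exact List.pairwise_insertionSort r l0

lemma mem_hull3 {A : Set (ℝ × ℝ)} {p x z y : ℝ × ℝ} (hp : p ∈ A) (hx : x ∈ A) (hz : z ∈ A)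
    {a b : ℝ} (ha : 0 ≤ a) (hb : 0 ≤ b) (hab : a + b ≤ 1)
    (h : y - p = a • (x - p) + b • (z - p)) : y ∈ convexHull ℝ A := by
  have hc := convex_convexHull ℝ A
  have hs : ∀ w ∈ A, w ∈ convexHull ℝ A := fun w hw => subset_convexHull ℝ A hw
  have : y = (1 - a - b) • p + a • x + b • z := by
    have : y = p + (y - p) := by abel
    rw [this, h]
    ext <;> simp <;> ring
  rw [this]
  have := hc.sum_mem (t := Finset.univ) (w := ![1 - a - b, a, b]) (z := ![p, x, z])
    (by intro i _; fin_cases i <;> simp <;> linarith)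
    (by simp [Fin.sum_univ_three]; ring) (by intro i _; fin_cases i <;> simp [hs _ hp, hs _ hx, hs _ hz])
  simpa [Fin.sum_univ_three] using this

lemma construct0 (S : Finset (ℝ × ℝ)) (hS : S.Nonempty) :
    ∃ Q : ClockPolygon, (∀ i, Q.verts i ∈ S) ∧ Q.body = convexHull ℝ (S : Set (ℝ × ℝ)) ∧
      (3 ≤ Q.n → ¬ Coll Q) := by
  classical
  obtain ⟨T, hTS, hhull, hmin⟩ := exists_minimal_hull S
  have hTne : T.Nonempty := by
    by_contra h
    rw [Finset.not_nonempty_iff_eq_empty] at h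
    rw [h] at hhull
    obtain ⟨x, hx⟩ := hS
    have : x ∈ convexHull ℝ (S : Set (ℝ × ℝ)) := subset_convexHull _ _ hx
    rw [← hhull] at this
    simp at this
  obtain ⟨p, hp, hlex⟩ := exists_lexmin T hTne
  obtain ⟨l, hnd, hmem, hsort⟩ := exists_sorted p (T.erase p)
    (fun x hx => hlex x (Finset.mem_of_mem_erase hx) (Finset.ne_of_mem_erase hx))
  have hstrict : l.Pairwise (fun x y => det2 (x - p) (y - p) < 0) := by
    refine (hsort.and hnd).imp_of_mem ?_
    intro x y hx hy h
    obtain ⟨h1, h2⟩ := h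
    rw [hmem, Finset.mem_erase] at hx hy
    refine lt_of_le_of_ne h1 fun h0 => ?_
    obtain ⟨c, hc, hcy⟩ := HP_smul_pos (hlex x hx.2 hx.1) (hlex y hy.2 hy.1) h0
    rcases le_total c 1 with hc1 | hc1
    · apply hmin y hy.2
      refine mem_hull3 (p := p) (x := x) (z := x) (a := c) (b := 0) ?_ ?_ ?_ hc.le le_rfl
        (by linarith) (by rw [hcy]; simp)
      · simp [hp, hy.1.symm]
      · simp [hx.2, h2]
      · simp [hx.2, h2]
    · apply hmin x hx.2
      refine mem_hull3 (p := p) (x := y) (z := y) (a := c⁻¹) (b := 0) ?_ ?_ ?_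
        (inv_nonneg.2 hc.le) le_rfl
        (by rw [add_zero]; exact inv_le_one_of_one_le₀ hc1)
        (by rw [hcy, smul_smul, inv_mul_cancel₀ hc.ne']; simp)
      · simp [hp, hx.1.symm]
      · simp [hy.2, Ne.symm h2]
      · simp [hy.2, Ne.symm h2]
  set L : List (ℝ × ℝ) := p :: l with hL
  have hLnd : L.Nodup := by
    rw [hL, List.nodup_cons]
    exact ⟨by rw [hmem]; simp, hnd⟩
  have hLmem : ∀ x, x ∈ L ↔ x ∈ T := by
    intro x
    rw [hL, List.mem_cons, hmem, Finset.mem_erase]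
    by_cases h : x = p
    · simp [h, hp]
    · simp [h]
  let C : ℕ → ℝ × ℝ := fun i => L.getD i p
  have hC : ∀ i (h : i < L.length), C i = L[i] := fun i h => by
    simp only [C]; exact List.getD_eq_getElem _ _ h
  have hC0 : C 0 = p := rfl
  have hlen : L.length = l.length + 1 := by rw [hL]; simp
  have hCs : ∀ i (h : i < l.length), C (i + 1) = l[i] := fun i h => by
    rw [hC (i + 1) (by omega)]; rfl
  have hCT : ∀ i, i < L.length → C i ∈ T := fun i h => by
    rw [hC i h, ← hLmem]; exact List.getElem_mem h
  have inj : ∀ i j, i < L.length → j < L.length → C i = C j → i = j := by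
    intro i j hi hj h
    rw [hC i hi, hC j hj] at h
    exact (hLnd.getElem_inj_iff).1 h
  have hst : ∀ j k, 0 < j → j < k → k < L.length → det2 (C j - C 0) (C k - C 0) < 0 := by
    intro j k hj hjk hk
    obtain ⟨j, rfl⟩ : ∃ j', j = j' + 1 := ⟨j - 1, by omega⟩
    obtain ⟨k, rfl⟩ : ∃ k', k = k' + 1 := ⟨k - 1, by omega⟩
    rw [hCs j (by omega), hCs k (by omega), hC0]
    exact (List.pairwise_iff_getElem.1 hstrict) j k _ _ (by omega)
  have tri : ∀ i j k, i < j → j < k → k < L.length → det2 (C j - C i) (C k - C i) ≤ 0 := by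
    intro i j k hij hjk hk
    rcases Nat.eq_zero_or_pos i with h | h
    · subst h; exact (hst j k hij hjk hk).le
    · by_contra hc
      push Not at hc
      have h1 := hst i j h hij (by omega)
      have h2 := hst j k (by omega) hjk hk
      have h3 := hst i k h (by omega) hk
      have hne0 : C 0 ≠ C j := fun h => by have := inj 0 j (by omega) (by omega) h; omega
      have hnei : C i ≠ C j := fun h => by have := inj i j (by omega) (by omega) h; omega
      have hnek : C k ≠ C j := fun h => by have := inj k j (by omega) (by omega) h; omega
      apply hmin (C j) (hCT j (by omega))
      obtain ⟨x, hx⟩ : ∃ x, x = C i - C 0 := ⟨_, rfl⟩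
      obtain ⟨y, hy⟩ : ∃ y, y = C j - C 0 := ⟨_, rfl⟩
      obtain ⟨z, hz⟩ : ∃ z, z = C k - C 0 := ⟨_, rfl⟩
      have e1 : C j - C i = y - x := by rw [hx, hy]; abel
      have e2 : C k - C i = z - x := by rw [hx, hz]; abel
      rw [e1, e2] at hc
      rw [← hx, ← hy] at h1
      rw [← hz, ← hy] at h2
      rw [← hx, ← hz] at h3
      have hc' : det2 x z < det2 y z + det2 x y := by
        simp only [det2, Prod.fst_sub, Prod.snd_sub] at *; linarith
      have h3' := h3.ne
      refine mem_hull3 (p := C 0) (x := C i) (z := C k) (a := det2 y z / det2 x z)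
        (b := det2 x y / det2 x z) ?_ ?_ ?_ (div_nonneg_of_nonpos h2.le h3.le)
        (div_nonneg_of_nonpos h1.le h3.le) ?_ ?_
      · simp [hne0, hCT 0 (by omega)]
      · simp [hnei, hCT i (by omega)]
      · simp [hnek, hCT k (by omega)]
      · rw [← add_div, div_le_one_of_neg h3]; exact hc'.le
      · rw [← hx, ← hy, ← hz]
        ext
        · simp only [Prod.fst_add, Prod.smul_fst, smul_eq_mul]
          field_simp
          simp only [det2]; ring
        · simp only [Prod.snd_add, Prod.smul_snd, smul_eq_mul]
          field_simp
          simp only [det2]; ring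
  obtain ⟨Q, hQn, hQ⟩ := mkPoly L.length (by omega) C inj tri
  have hmod : ∀ i, i % L.length < L.length := fun i => Nat.mod_lt _ (by omega)
  refine ⟨Q, fun i => ?_, ?_, ?_⟩
  · rw [hQ]; exact hTS (hCT _ (hmod i))
  · rw [← hhull]
    unfold ClockPolygon.body
    congr 1
    ext x
    constructor
    · rintro ⟨i, rfl⟩
      rw [hQ]; exact hCT _ (hmod i)
    · intro hx
      obtain ⟨i, hi, rfl⟩ := List.getElem_of_mem ((hLmem x).2 hx)
      exact ⟨i, by rw [hQ, Nat.mod_eq_of_lt hi, hC i hi]⟩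
  · rintro h3 ⟨e, o, he, h⟩
    rw [hQn] at h3
    have v : ∀ i, i < L.length → Q.verts i = C i := fun i hi => by rw [hQ, Nat.mod_eq_of_lt hi]
    have a0 := h _ (Q.verts_mem 0)
    have a1 := h _ (Q.verts_mem 1)
    have a2 := h _ (Q.verts_mem 2)
    rw [v _ (by omega), det2_sub_right] at a0 a1 a2
    have := hst 1 2 (by omega) (by omega) (by omega)
    obtain ⟨c, hc⟩ := exists_smul_of_det (x := e) (y := C 1 - C 0) he (by
      rw [det2_sub_right]; linarith)
    obtain ⟨c', hc'⟩ := exists_smul_of_det (x := e) (y := C 2 - C 0) he (by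
      rw [det2_sub_right]; linarith)
    rw [hc, hc', det2_smul_left, det2_smul_right, det2_self] at this
    simp at this

lemma construct {P : ClockPolygon} (hP : Good P) (S : Finset (ℝ × ℝ)) (hS : S.Nonempty) :
    ∃ Q : ClockPolygon, (∀ i, Q.verts i ∈ S) ∧ Q.body = convexHull ℝ (S : Set (ℝ × ℝ)) ∧
      omegaPerim P.body Q ≤ omegaPerim Q.body P := by
  obtain ⟨Q, h1, h2, h3⟩ := construct0 S hS
  refine ⟨Q, h1, h2, ?_⟩
  rcases good_or_coll Q with h | h
  · exact (perim_symm hP h).le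
  have hn : Q.n ≤ 2 := by
    by_contra hc
    exact h3 (by omega) h
  refine le_trans ?_ (seg_le P (body_compact Q) (Q.verts_mem 0) (Q.verts_mem 1))
  rw [← width_eq hP, omegaPerim_eq]
  have := Q.npos
  have hper := Q.periodic 0
  rcases (show Q.n = 1 ∨ Q.n = 2 by omega) with hn | hn
  · rw [hn] at hper ⊢
    simp only [zero_add] at hper
    simp [ClockPolygon.edge, hper, omegaLen_zero (body_ne P)]
  · rw [hn] at hper ⊢
    simp only [zero_add] at hper
    simp [Finset.sum_range_succ, ClockPolygon.edge, hper]

/-! ### Circumscribed polygon -/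

lemma circumscribe {P : ClockPolygon} (hP : Good P) (K : Set (ℝ × ℝ)) (hK : IsCompact K)
    (hne : K.Nonempty) :
    ∃ Q : ClockPolygon, EdgesParallel Q P ∧ K ⊆ Q.body ∧
      omegaPerim P.body Q ≤ omegaPerim K P := by
  classical
  let c : ℕ → ℝ := fun j => omegaLen K (P.edge j)
  have hcper : ∀ j, c (j + P.n) = c j := fun j => by simp only [c, P.edge_per]
  -- corner points
  let X : ℕ → ℝ × ℝ := fun j =>
    (1 / det2 (P.edge j) (P.edge (j + 1))) • (c j • P.edge (j + 1) - c (j + 1) • P.edge j)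
  have hX1 : ∀ j, det2 (P.edge j) (P.edge (j + 1)) < 0 → det2 (P.edge j) (X j) = c j := by
    intro j hj
    simp only [X]
    rw [det2_smul_right, det2_sub_right, det2_smul_right, det2_smul_right, det2_self]
    field_simp [hj.ne]
    ring
  have hX2 : ∀ j, det2 (P.edge j) (P.edge (j + 1)) < 0 →
      det2 (P.edge (j + 1)) (X j) = c (j + 1) := by
    intro j hj
    simp only [X]
    rw [det2_smul_right, det2_sub_right, det2_smul_right, det2_smul_right, det2_self,
      det2_swap (P.edge (j + 1)) (P.edge j)]
    field_simp [hj.ne]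
    ring
  have hXper : ∀ j, X (j + P.n) = X j := by
    intro j
    simp only [X]
    rw [add_right_comm, P.edge_per, P.edge_per, hcper, hcper]
  have hXc : ∀ j, det2 (P.edge j) (P.edge (j + 1)) < 0 → ∀ k, det2 (P.edge k) (X j) ≤ c k := by
    intro j hj k
    by_contra hcon
    push Not at hcon
    obtain ⟨a, ha, ea, ma⟩ := omegaLen_attained hK hne (P.edge j)
    obtain ⟨b, hb, eb, mb⟩ := omegaLen_attained hK hne (P.edge (j + 1))
    have hka : det2 (P.edge k) a ≤ c k := le_omegaLen hK _ ha
    have hkb : det2 (P.edge k) b ≤ c k := le_omegaLen hK _ hb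
    have hja : det2 (P.edge (j + 1)) a ≤ c (j + 1) := le_omegaLen hK _ ha
    have hjb : det2 (P.edge j) b ≤ c j := le_omegaLen hK _ hb
    have h1 := hX1 j hj
    have h2 := hX2 j hj
    have ea' : det2 (P.edge j) a = c j := ea.symm
    have eb' : det2 (P.edge (j + 1)) b = c (j + 1) := eb.symm
    -- directions
    obtain ⟨s, hs⟩ := exists_smul_of_det (x := P.edge j) (y := X j - a) (hP j).1
      (by rw [det2_sub_right]; linarith)
    obtain ⟨t, ht⟩ := exists_smul_of_det (x := P.edge (j + 1)) (y := X j - b) (hP (j + 1)).1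
      (by rw [det2_sub_right]; linarith)
    have sw := det2_swap (P.edge j) (P.edge (j + 1))
    have s1 : 0 < s * det2 (P.edge k) (P.edge j) := by
      rw [← det2_smul_right, ← hs, det2_sub_right]; linarith
    have t1 : 0 < t * det2 (P.edge k) (P.edge (j + 1)) := by
      rw [← det2_smul_right, ← ht, det2_sub_right]; linarith
    have s2 : 0 ≤ s * det2 (P.edge (j + 1)) (P.edge j) := by
      rw [← det2_smul_right, ← hs, det2_sub_right]; linarith
    have t2 : 0 ≤ t * det2 (P.edge j) (P.edge (j + 1)) := by
      rw [← det2_smul_right, ← ht, det2_sub_right]; linarith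
    have s3 : 0 ≤ s := by
      by_contra h; push Not at h; nlinarith
    have t3 : t ≤ 0 := by
      by_contra h; push Not at h; nlinarith
    have s4 : 0 < det2 (P.edge k) (P.edge j) := by
      by_contra h; push Not at h; nlinarith
    have t4 : det2 (P.edge k) (P.edge (j + 1)) < 0 := by
      by_contra h; push Not at h; nlinarith
    have s5 : det2 (P.edge j) (P.edge k) < 0 := by rw [det2_swap]; linarith
    have hcone : InCone (P.edge j) (P.edge (j + 1)) (P.edge k) := ⟨hj, s5.le, t4.le⟩
    obtain ⟨α, β, hα, hβ, hk⟩ := hcone.exists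
    have hα' : 0 < α := by
      rcases hα.lt_or_eq with h | h
      · exact h
      · rw [hk, ← h, zero_smul, zero_add, det2_smul_left, det2_self] at t4; simp at t4
    have hβ' : 0 < β := by
      rcases hβ.lt_or_eq with h | h
      · exact h
      · rw [hk, ← h, zero_smul, add_zero, det2_smul_right, det2_self] at s5; simp at s5
    have huniq : ∀ q ∈ P.body, det2 (P.edge k) (P.verts (j + 1)) ≤ det2 (P.edge k) q →
        q = P.verts (j + 1) := by
      intro q hq hle
      have a1 := clock' P j hq
      have a2 := clock' P (j + 1) hq
      rw [← det2_edge_succ] at a1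
      rw [hk] at hle
      simp only [det2_add_left, det2_smul_left] at hle
      have b1 : det2 (P.edge j) (q - P.verts (j + 1)) = 0 := by
        rw [det2_sub_right]; nlinarith
      have b2 : det2 (P.edge (j + 1)) (q - P.verts (j + 1)) = 0 := by
        rw [det2_sub_right]; nlinarith
      obtain ⟨r, hr⟩ := exists_smul_of_det (hP j).1 b1
      rw [hr, det2_smul_right] at b2
      have : r = 0 := by
        rcases mul_eq_zero.1 b2 with h | h
        · exact h
        · linarith
      rw [this, zero_smul] at hr
      exact sub_eq_zero.1 hr
    have w1 := huniq _ (P.verts_mem k) (clock' P k (P.verts_mem (j + 1)))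
    have w2 := huniq _ (P.verts_mem (k + 1)) (by
      rw [det2_edge_succ]; exact clock' P k (P.verts_mem (j + 1)))
    exact (hP k).1 (by unfold ClockPolygon.edge; rw [w1, w2, sub_self])
  let S : Finset (ℝ × ℝ) := ((Finset.range P.n).filter
    fun j => det2 (P.edge j) (P.edge (j + 1)) < 0).image X
  have hXS : ∀ j, det2 (P.edge j) (P.edge (j + 1)) < 0 → X j ∈ S := by
    intro j hj
    have p1 : Function.Periodic P.edge P.n := P.edge_per
    have p2 : Function.Periodic X P.n := hXper
    have p3 : Function.Periodic (fun j => det2 (P.edge j) (P.edge (j + 1))) P.n := fun i => by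
      change det2 (P.edge (i + P.n)) (P.edge (i + P.n + 1)) = _
      rw [add_right_comm, P.edge_per, P.edge_per]
    refine Finset.mem_image.2 ⟨j % P.n, ?_, p2.map_mod_nat j⟩
    rw [Finset.mem_filter, Finset.mem_range]
    refine ⟨Nat.mod_lt _ P.npos, ?_⟩
    have := p3.map_mod_nat j
    change det2 (P.edge (j % P.n)) (P.edge (j % P.n + 1)) = _ at this
    rw [this]; exact hj
  have hSne : S.Nonempty := by
    obtain ⟨t, ht⟩ := good_cone hP (u := (1, 0)) (by simp)
    exact ⟨_, hXS t ht.1⟩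
  have hSc : ∀ x ∈ S, ∀ k, det2 (P.edge k) x ≤ c k := by
    intro x hx k
    obtain ⟨j, hj, rfl⟩ := Finset.mem_image.1 hx
    exact hXc j (Finset.mem_filter.1 hj).2 k
  obtain ⟨Q, hQv, hQb, hQp⟩ := construct hP S hSne
  have hQc : ∀ x ∈ Q.body, ∀ k, det2 (P.edge k) x ≤ c k := by
    intro x hx k
    rw [hQb] at hx
    exact convexHull_min (t := {z | det2 (P.edge k) z ≤ c k}) (fun y hy => hSc y hy k)
      (convex_halfSpace_le (det2_lin _) _) hx
  refine ⟨Q, ?_, ?_, hQp.trans ?_⟩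
  · intro i hi hne0
    change Q.edge i ≠ 0 at hne0
    obtain ⟨t, ht⟩ := good_cone hP hne0
    have hlt := ht.1
    obtain ⟨α, β, hα, hβ, he⟩ := ht.exists
    have hmodpar : ∀ (t : ℕ) (a : ℝ), Q.edge i = a • P.edge t →
        ∃ j < P.n, ∃ t : ℝ, t ≠ 0 ∧
          Q.verts (i + 1) - Q.verts i = t • (P.verts (j + 1) - P.verts j) := by
      intro t a h
      have p1 : Function.Periodic P.edge P.n := P.edge_per
      refine ⟨t % P.n, Nat.mod_lt _ P.npos, a, ?_, ?_⟩
      · rintro rfl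
        rw [zero_smul] at h; exact hne0 h
      · change Q.edge i = a • P.edge (t % P.n)
        rw [p1.map_mod_nat, h]
    rcases hα.lt_or_eq with hα' | hα'
    · rcases hβ.lt_or_eq with hβ' | hβ'
      · exfalso
        have hXb : X t ∈ Q.body := by
          rw [hQb]; exact subset_convexHull _ _ (hXS t hlt)
        have huniq : ∀ q ∈ Q.body, det2 (Q.edge i) (X t) ≤ det2 (Q.edge i) q → q = X t := by
          intro q hq hle
          have a1 := hQc q hq t
          have a2 := hQc q hq (t + 1)
          rw [← hX1 t hlt] at a1
          rw [← hX2 t hlt] at a2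
          rw [he] at hle
          simp only [det2_add_left, det2_smul_left] at hle
          have b1 : det2 (P.edge t) (q - X t) = 0 := by
            rw [det2_sub_right]; nlinarith
          have b2 : det2 (P.edge (t + 1)) (q - X t) = 0 := by
            rw [det2_sub_right]; nlinarith
          obtain ⟨r, hr⟩ := exists_smul_of_det (hP t).1 b1
          rw [hr, det2_smul_right] at b2
          have sw := det2_swap (P.edge t) (P.edge (t + 1))
          have : r = 0 := by
            rcases mul_eq_zero.1 b2 with h | h
            · exact h
            · linarith
          rw [this, zero_smul] at hr
          exact sub_eq_zero.1 hr
        have w1 := huniq _ (Q.verts_mem i) (clock' Q i hXb)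
        have w2 := huniq _ (Q.verts_mem (i + 1)) (by rw [det2_edge_succ]; exact clock' Q i hXb)
        exact hne0 (by unfold ClockPolygon.edge; rw [w1, w2, sub_self])
      · exact hmodpar t α (by rw [he, ← hβ', zero_smul, add_zero])
    · exact hmodpar (t + 1) β (by rw [he, ← hα', zero_smul, zero_add])
  · intro q hq
    by_contra hcon
    obtain ⟨f, u, hf1, hf2⟩ := geometric_hahn_banach_closed_point
      (s := Q.body) (x := q) (convex_convexHull _ _) (body_compact Q).isClosed hcon
    let w : ℝ × ℝ := (f (0, 1), -f (1, 0))
    have hw : ∀ z, f z = det2 w z := by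
      intro z
      have : z = z.1 • ((1, 0) : ℝ × ℝ) + z.2 • ((0, 1) : ℝ × ℝ) := by ext <;> simp
      conv_lhs => rw [this]
      rw [map_add, map_smul, map_smul]
      simp only [w, det2, smul_eq_mul]; ring
    have hw0 : w ≠ 0 := by
      intro h
      have a := hf1 _ (Q.verts_mem 0)
      rw [hw, h, det2_zero_left] at a hf2
      linarith
    obtain ⟨t, ht⟩ := good_cone hP hw0
    have hlt := ht.1
    obtain ⟨α, β, hα, hβ, he⟩ := ht.exists
    have hXb : X t ∈ Q.body := by
      rw [hQb]; exact subset_convexHull _ _ (hXS t hlt)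
    have a1 : det2 (P.edge t) q ≤ c t := le_omegaLen hK _ hq
    have a2 : det2 (P.edge (t + 1)) q ≤ c (t + 1) := le_omegaLen hK _ hq
    rw [← hX1 t hlt] at a1
    rw [← hX2 t hlt] at a2
    have b := (hf1 _ hXb).trans hf2
    rw [hw, hw, he] at b
    simp only [det2_add_left, det2_smul_left] at b
    nlinarith [mul_le_mul_of_nonneg_left a1 hα, mul_le_mul_of_nonneg_left a2 hβ]
  · rw [omegaPerim_eq, omegaPerim_eq]
    refine Finset.sum_le_sum fun k _ => ?_
    obtain ⟨w, hw, e, -⟩ := omegaLen_attained (body_compact Q) (body_ne Q) (P.edge k)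
    rw [e]
    exact hQc w hw k

/-! Part 5: final assembly -/

def rotL (s : ℝ) : (ℝ × ℝ) →ₗ[ℝ] (ℝ × ℝ) where
  toFun p := (-s * p.2, s * p.1)
  map_add' p q := by ext <;> simp <;> ring
  map_smul' c p := by ext <;> simp <;> ring

lemma rotL_apply (s : ℝ) (p : ℝ × ℝ) : rotL s p = (-s * p.2, s * p.1) := rfl

lemma rotL_inj {s : ℝ} (hs : s * s = 1) : Function.Injective (rotL s) := by
  intro p q h
  have hs0 : s ≠ 0 := by rintro rfl; simp at hs
  simp only [rotL_apply, Prod.mk.injEq] at h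
  ext
  · exact mul_left_cancel₀ hs0 h.2
  · exact mul_left_cancel₀ (neg_ne_zero.2 hs0) h.1

lemma rotL_det {s : ℝ} (hs : s * s = 1) (p q : ℝ × ℝ) :
    det2 (rotL s p) (rotL s q) = det2 p q := by
  simp only [rotL_apply, det2]
  linear_combination (p.1 * q.2 - p.2 * q.1) * hs

lemma rotL_range {s : ℝ} (f : ℕ → ℝ × ℝ) :
    convexHull ℝ (Set.range fun i => rotL s (f i)) = rotL s '' convexHull ℝ (Set.range f) := by
  rw [LinearMap.image_convexHull, ← Set.range_comp]
  rfl

def rot (s : ℝ) (hs : s * s = 1) (Q : ClockPolygon) : ClockPolygon where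
  n := Q.n
  npos := Q.npos
  verts i := rotL s (Q.verts i)
  periodic i := by simp only [Q.periodic i]
  inj i j hi hj h := Q.inj i j hi hj (rotL_inj hs h)
  clockwise i q hq := by
    rw [rotL_range] at hq
    obtain ⟨q, hq, rfl⟩ := hq
    rw [← map_sub, ← map_sub, rotL_det hs]
    exact Q.clockwise i q hq

lemma rot_body (s : ℝ) (hs : s * s = 1) (Q : ClockPolygon) :
    (rot s hs Q).body = rotL s '' Q.body := rotL_range Q.verts

lemma rotL_lattice {s : ℝ} (hs : s = 1 ∨ s = -1) (p : ℝ × ℝ) :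
    IsLatticePt (rotL s p) ↔ IsLatticePt p := by
  unfold IsLatticePt
  rcases hs with rfl | rfl
  · simp only [rotL_apply]
    constructor
    · rintro ⟨⟨a, ha⟩, b, hb⟩
      exact ⟨⟨b, by linarith⟩, -a, by push_cast; linarith⟩
    · rintro ⟨⟨a, ha⟩, b, hb⟩
      exact ⟨⟨-b, by push_cast; linarith⟩, a, by linarith⟩
  · simp only [rotL_apply]
    constructor
    · rintro ⟨⟨a, ha⟩, b, hb⟩
      exact ⟨⟨-b, by push_cast; linarith⟩, a, by linarith⟩
    · rintro ⟨⟨a, ha⟩, b, hb⟩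
      exact ⟨⟨b, by linarith⟩, -a, by push_cast; linarith⟩

lemma rot_count {s : ℝ} (h : s = 1 ∨ s = -1) (hs : s * s = 1) (Q : ClockPolygon) :
    latticeCount (rot s hs Q).body = latticeCount Q.body := by
  unfold latticeCount
  rw [rot_body, ← Set.ncard_image_of_injective {p ∈ Q.body | IsLatticePt p} (rotL_inj hs)]
  congr 1
  ext p
  constructor
  · rintro ⟨⟨q, hq, rfl⟩, hl⟩
    exact ⟨q, ⟨hq, (rotL_lattice h q).1 hl⟩, rfl⟩
  · rintro ⟨q, ⟨hq, hl⟩, rfl⟩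
    exact ⟨⟨q, hq, rfl⟩, (rotL_lattice h q).2 hl⟩

lemma rot_perim (K : Set (ℝ × ℝ)) (Q : ClockPolygon) :
    dualPerim K (rot 1 (by norm_num) Q) = omegaPerim K Q := by
  unfold dualPerim omegaPerim
  refine Finset.sum_congr rfl fun i _ => ?_
  unfold dualLen omegaLen
  congr 2
  funext p
  simp [rot, rotL_apply, dot2, det2]
  ring

lemma rot_perim' (K : Set (ℝ × ℝ)) (Q : ClockPolygon) :
    omegaPerim K (rot (-1) (by norm_num) Q) = dualPerim K Q := by
  unfold dualPerim omegaPerim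
  refine Finset.sum_congr rfl fun i _ => ?_
  unfold dualLen omegaLen
  congr 2
  funext p
  simp [rot, rotL_apply, dot2, det2]
  ring

lemma good_of_interior {P : ClockPolygon} {v : ℝ × ℝ} (hv : v ∈ interior P.body) : Good P := by
  rcases good_or_coll P with h | ⟨e, p, he, h⟩
  · exact h
  exfalso
  have hc : Filter.Tendsto (fun t : ℝ => v + t • ((-e.2, e.1) : ℝ × ℝ)) (nhds 0) (nhds v) := by
    have : Continuous (fun t : ℝ => v + t • ((-e.2, e.1) : ℝ × ℝ)) := by fun_prop
    simpa using this.tendsto 0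
  have hn := hc (mem_interior_iff_mem_nhds.1 hv)
  obtain ⟨ε, hε, hb⟩ := Metric.mem_nhds_iff.1 hn
  have h1 := hb (show ε / 2 ∈ Metric.ball (0:ℝ) ε by
    rw [Metric.mem_ball, Real.dist_eq, sub_zero, abs_of_pos (by positivity)]; linarith)
  have h1 := h _ h1
  have h2 := h _ (interior_subset hv)
  have h3 : ε / 2 * (e.1 * e.1 + e.2 * e.2) = 0 := by
    simp only [det2, Prod.fst_sub, Prod.snd_sub, Prod.fst_add, Prod.snd_add, Prod.smul_fst,
      Prod.smul_snd, smul_eq_mul] at h1 h2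
    linarith
  have h4 : e.1 * e.1 + e.2 * e.2 = 0 := by
    rcases mul_eq_zero.1 h3 with h | h
    · linarith
    · exact h
  apply he
  ext
  · exact mul_self_eq_zero.1 (by nlinarith [mul_self_nonneg e.1, mul_self_nonneg e.2])
  · exact mul_self_eq_zero.1 (by nlinarith [mul_self_nonneg e.1, mul_self_nonneg e.2])

lemma omegaLen_trans {K : Set (ℝ × ℝ)} (hK : IsCompact K) (hne : K.Nonempty) (v u : ℝ × ℝ) :
    omegaLen ((· - v) '' K) u = omegaLen K u - det2 u v := by
  obtain ⟨w, hw, h, hm⟩ := omegaLen_attained hK hne u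
  rw [h, ← det2_sub_right]
  apply omegaLen_eq_of_max (p := w - v) (Set.mem_image_of_mem (· - v) hw)
  rintro _ ⟨q, hq, rfl⟩
  simp only [det2_sub_right]
  linarith [hm q hq]

lemma omegaPerim_trans {K : Set (ℝ × ℝ)} (hK : IsCompact K) (hne : K.Nonempty) (v : ℝ × ℝ)
    (Q : ClockPolygon) : omegaPerim ((· - v) '' K) Q = omegaPerim K Q := by
  rw [omegaPerim_eq, omegaPerim_eq]
  simp only [omegaLen_trans hK hne]
  rw [Finset.sum_sub_distrib, ← det2_sum_left, sum_edge, det2_zero_left, sub_zero]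

lemma omegaPerim_nonneg {K : Set (ℝ × ℝ)} (hK : IsCompact K) (hne : K.Nonempty)
    (Q : ClockPolygon) : 0 ≤ omegaPerim K Q := by
  obtain ⟨v, hv⟩ := hne
  have : ∑ i ∈ Finset.range Q.n, det2 (Q.edge i) v ≤ omegaPerim K Q := by
    rw [omegaPerim_eq]
    exact Finset.sum_le_sum fun i _ => le_omegaLen hK _ hv
  rwa [← det2_sum_left, sum_edge, det2_zero_left] at this

lemma omegaPerim_mono {K K' : Set (ℝ × ℝ)} (hK : IsCompact K) (hne : K.Nonempty)
    (hK' : IsCompact K') (h : K ⊆ K') (Q : ClockPolygon) : omegaPerim K Q ≤ omegaPerim K' Q := by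
  rw [omegaPerim_eq, omegaPerim_eq]
  refine Finset.sum_le_sum fun i _ => ?_
  obtain ⟨w, hw, h1, -⟩ := omegaLen_attained hK hne (Q.edge i)
  rw [h1]
  exact le_omegaLen hK' _ (h hw)

lemma lattice_finite {K : Set (ℝ × ℝ)} (hK : IsCompact K) : {p ∈ K | IsLatticePt p}.Finite := by
  obtain ⟨C, hC⟩ := hK.isBounded.exists_norm_le
  have hf : ((fun z : ℤ × ℤ => ((z.1 : ℝ), (z.2 : ℝ))) ''
      (Set.Icc (-⌈C⌉) ⌈C⌉ ×ˢ Set.Icc (-⌈C⌉) ⌈C⌉)).Finite :=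
    ((Set.finite_Icc _ _).prod (Set.finite_Icc _ _)).image _
  refine hf.subset ?_
  rintro ⟨x, y⟩ ⟨hp, ⟨a, ha⟩, b, hb⟩
  simp only at ha hb
  subst ha hb
  have h := hC _ hp
  have h1 := (norm_fst_le _).trans h
  have h2 := (norm_snd_le _).trans h
  simp only [Real.norm_eq_abs, abs_le] at h1 h2
  have hc := Int.le_ceil C
  refine ⟨(a, b), ⟨⟨?_, ?_⟩, ⟨?_, ?_⟩⟩, rfl⟩
  all_goals
    simp only
    have : ((-⌈C⌉ : ℤ) : ℝ) = -(⌈C⌉ : ℝ) := by push_cast; rfl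
    rw [← Int.cast_le (R := ℝ)]
    linarith

lemma HP_convex (x : ℝ × ℝ) : Convex ℝ {q | HP (q - x)} := by
  intro p hp q hq a b ha hb hab
  simp only [HP, Set.mem_setOf_eq, Prod.fst_sub, Prod.snd_sub, Prod.fst_add, Prod.snd_add,
    Prod.smul_fst, Prod.smul_snd, smul_eq_mul] at *
  have e1 : a * p.1 + b * q.1 - x.1 = a * (p.1 - x.1) + b * (q.1 - x.1) := by
    linear_combination x.1 * hab
  have e2 : a * p.2 + b * q.2 - x.2 = a * (p.2 - x.2) + b * (q.2 - x.2) := by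
    linear_combination x.2 * hab
  rw [e1, e2]
  rcases ha.eq_or_lt with rfl | ha
  · have : b = 1 := by linarith
    subst this; simpa using hq
  rcases hb.eq_or_lt with rfl | hb
  · have : a = 1 := by linarith
    subst this; simpa using hp
  rcases hp with hp | ⟨hp, hp'⟩ <;> rcases hq with hq | ⟨hq, hq'⟩
  · left; positivity
  · left; rw [hq]; simp only [mul_zero, add_zero]; positivity
  · left; rw [hp]; simp only [mul_zero, zero_add]; positivity
  · right; rw [hp, hq]; simp only [mul_zero, add_zero, true_and]; positivity

lemma reduce (m : ℕ) (hm : 0 < m) : ∀ d : ℕ, ∀ S : Finset (ℝ × ℝ), S.card = m + d →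
    (∀ q ∈ convexHull ℝ (S : Set (ℝ × ℝ)), IsLatticePt q ↔ q ∈ S) →
    ∃ T ⊆ S, T.card = m ∧ (∀ q ∈ convexHull ℝ (T : Set (ℝ × ℝ)), IsLatticePt q ↔ q ∈ T) := by
  classical
  intro d
  induction d with
  | zero => intro S hc h; exact ⟨S, subset_rfl, hc, h⟩
  | succ d ih =>
    intro S hc h
    have hS : S.Nonempty := by rw [← Finset.card_pos]; omega
    obtain ⟨p, hp, hlex⟩ := exists_lexmin S hS
    have hsub : convexHull ℝ ((S.erase p : Finset _) : Set (ℝ × ℝ)) ⊆ {q | HP (q - p)} := by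
      apply convexHull_min _ (HP_convex p)
      intro q hq
      have hq := Finset.mem_erase.1 (Finset.mem_coe.1 hq)
      exact hlex q hq.2 hq.1
    obtain ⟨T, hT, hTc, hTl⟩ := ih (S.erase p) (by rw [Finset.card_erase_of_mem hp]; omega) (by
      intro q hq
      rw [h q (convexHull_mono (by exact_mod_cast Finset.erase_subset p S) hq), Finset.mem_erase]
      have : q ≠ p := by
        rintro rfl
        exact HP_ne (hsub hq) (sub_self _)
      tauto)
    exact ⟨T, hT.trans (Finset.erase_subset p S), hTc, hTl⟩

lemma dirA {P : ClockPolygon} (hP : Good P) {k : ℕ} (Λ : ClockPolygon)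
    (hc : latticeCount Λ.body = k + 1) : ∃ Ξ, EdgesParallel Ξ P ∧ k + 1 ≤ latticeCount Ξ.body ∧
      omegaPerim P.body Ξ ≤ omegaPerim P.body Λ := by
  obtain ⟨Ξ, h1, h2, h3⟩ := circumscribe hP Λ.body (body_compact Λ) (body_ne Λ)
  refine ⟨Ξ, h1, ?_, h3.trans (perim_ge hP Λ)⟩
  rw [← hc]
  exact Set.ncard_le_ncard (fun q hq => ⟨h2 hq.1, hq.2⟩) (lattice_finite (body_compact Ξ))

lemma dirB {P : ClockPolygon} (hP : Good P) {k : ℕ} (Ξ : ClockPolygon)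
    (hc : k + 1 ≤ latticeCount Ξ.body) : ∃ Q : ClockPolygon, (∀ i, IsLatticePt (Q.verts i)) ∧
      latticeCount Q.body = k + 1 ∧ omegaPerim P.body Q ≤ omegaPerim P.body Ξ := by
  classical
  have hf := lattice_finite (body_compact Ξ)
  set L := hf.toFinset with hL
  have hcard : L.card = latticeCount Ξ.body := by
    rw [latticeCount, Set.ncard_eq_toFinset_card _ hf]
  have hLb : convexHull ℝ (L : Set (ℝ × ℝ)) ⊆ Ξ.body := by
    apply convexHull_min _ (convex_convexHull ℝ _)
    intro q hq
    exact ((Set.Finite.mem_toFinset hf).1 (Finset.mem_coe.1 hq)).1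
  obtain ⟨T, hTL, hTc, hT⟩ := reduce (k + 1) (by omega) (L.card - (k + 1)) L (by omega) (by
    intro q hq
    rw [hL, Set.Finite.mem_toFinset]
    exact ⟨fun h => ⟨hLb hq, h⟩, fun h => h.2⟩)
  have hTne : T.Nonempty := by rw [← Finset.card_pos]; omega
  obtain ⟨Q, h1, h2, h3⟩ := construct hP T hTne
  have hset : {p ∈ Q.body | IsLatticePt p} = (T : Set (ℝ × ℝ)) := by
    ext q
    rw [h2]
    constructor
    · rintro ⟨a, b⟩; exact Finset.mem_coe.2 ((hT q a).1 b)
    · intro h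
      have := subset_convexHull ℝ (T : Set (ℝ × ℝ)) h
      exact ⟨this, (hT q this).2 (Finset.mem_coe.1 h)⟩
  refine ⟨Q, fun i => ?_, ?_, ?_⟩
  · have := Finset.mem_coe.2 (h1 i)
    rw [← hset] at this
    exact this.2
  · rw [latticeCount, hset, Set.ncard_coe_finset, hTc]
  · refine h3.trans ((omegaPerim_mono (body_compact Q) (body_ne Q) (body_compact Ξ) ?_ P).trans
      (perim_ge hP Ξ))
    rw [h2]
    exact (convexHull_mono (by exact_mod_cast hTL)).trans hLb

lemma sInf_eq_of_dom {A B : Set ℝ} (hA : ∀ a ∈ A, 0 ≤ a) (hB : ∀ b ∈ B, 0 ≤ b)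
    (h1 : ∀ a ∈ A, ∃ b ∈ B, b ≤ a) (h2 : ∀ b ∈ B, ∃ a ∈ A, a ≤ b) : sInf A = sInf B := by
  rcases A.eq_empty_or_nonempty with rfl | hAn
  · have : B = ∅ := by
      ext b
      constructor
      · intro hb; obtain ⟨a, ha, -⟩ := h2 b hb; exact ha
      · intro h; exact h.elim
    rw [this]
  have hBn : B.Nonempty := by
    obtain ⟨a, ha⟩ := hAn
    obtain ⟨b, hb, -⟩ := h1 a ha
    exact ⟨b, hb⟩
  apply le_antisymm
  · apply le_csInf hBn
    intro b hb
    obtain ⟨a, ha, hab⟩ := h2 b hb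
    exact (csInf_le ⟨0, hA⟩ ha).trans hab
  · apply le_csInf hAn
    intro a ha
    obtain ⟨b, hb, hab⟩ := h1 a ha
    exact (csInf_le ⟨0, hB⟩ hb).trans hab

/-- For a free rational convex toric domain `X_Ω`
(`Ω ⊂ (0,∞)²` a rational polygon with nonempty interior) and any interior
point `v⋆`, the Hutchings minimum of `ℓ'_Ω(∂Λ)` over lattice polygons with
exactly `k+1` lattice points equals the infimum of `ℓ_{Ω'}(∂Ξ)`
(`Ω' = Ω − v⋆`) over polygons `Ξ` with edges parallel to edges of `Ω` and at
least `k+1` lattice points. -/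
theorem free_domain_cap_reform (P : ClockPolygon)
    (hrat : ∀ i, IsRationalPt (P.verts i))
    (hint : (interior P.body).Nonempty)
    (hpos : ∀ q ∈ P.body, 0 < q.1 ∧ 0 < q.2)
    (v : ℝ × ℝ) (hv : v ∈ interior P.body) (k : ℕ) :
    sInf { r | ∃ Λ : ClockPolygon, (∀ i, IsLatticePt (Λ.verts i)) ∧
        latticeCount Λ.body = k + 1 ∧ dualPerim ((· - v) '' P.body) Λ = r } =
    sInf { r | ∃ Ξ : ClockPolygon, EdgesParallel Ξ P ∧
        k + 1 ≤ latticeCount Ξ.body ∧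
        omegaPerim ((· - v) '' P.body) Ξ = r } := by
  have hP : Good P := good_of_interior hv
  have htr := omegaPerim_trans (body_compact P) (body_ne P) v
  apply sInf_eq_of_dom
  · rintro _ ⟨Λ, -, -, rfl⟩
    rw [← rot_perim', htr]
    exact omegaPerim_nonneg (body_compact P) (body_ne P) _
  · rintro _ ⟨Ξ, -, -, rfl⟩
    rw [htr]
    exact omegaPerim_nonneg (body_compact P) (body_ne P) _
  · rintro _ ⟨Λ, -, hc, rfl⟩
    rw [← rot_perim', htr]
    obtain ⟨Ξ, h1, h2, h3⟩ := dirA hP (rot (-1) (by norm_num) Λ)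
      (by rw [rot_count (Or.inr rfl)]; exact hc)
    exact ⟨_, ⟨Ξ, h1, h2, rfl⟩, by rw [htr]; exact h3⟩
  · rintro _ ⟨Ξ, -, hc, rfl⟩
    rw [htr]
    obtain ⟨Q, h1, h2, h3⟩ := dirB hP Ξ hc
    refine ⟨_, ⟨rot 1 (by norm_num) Q, fun i => (rotL_lattice (Or.inl rfl) _).2 (h1 i), ?_, rfl⟩, ?_⟩
    · rw [rot_count (Or.inl rfl)]; exact h2
    · rw [rot_perim, htr]; exact h3

end
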